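/- arXiv:2504.18037 — 12 statements merged into one kernel-verified Lean document; each statement's English description precedes it below -/
import Mathlib

section
/- Assume f_1 ≥ f_2 ≥ … ≥ f_n ≥ 0 and b_1 ≥ b_2 ≥ … ≥ b_m. Let x ∈ 𝒳, and suppose i < i' in [n] and j < j' in [m] satisfy x_{ij'} > 0 and x_{i'j} > 0. Set ε := min{x_{ij'}, x_{i'j}} and let x' be obtained from x by decreasing the entries x_{ij'} and x_{i'j} by ε and increasing the entries x_{ij} and x_{i'j'} by ε. Then x' ∈ 𝒳 and ∑_{(p,q) ∈ [n]×[m]} (f_p / b_q) · x'_{pq} ≤ ∑_{(p,q) ∈ [n]×[m]} (f_p / b_q) · x_{pq}. -/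
open Finset

/-- Pairing a coefficient matrix with a matrix supported on a single entry. -/
lemma sum_sum_mul_ite_and_eq {α β : Type*} [Fintype α] [Fintype β] [DecidableEq α]
    [DecidableEq β] (c : α → β → ℝ) (i : α) (j : β) (ε : ℝ) :
    ∑ p, ∑ q, c p q * (if p = i ∧ q = j then ε else 0) = c i j * ε := by
  simp [ite_and]

/-- Exchanging flow on a crossing pair of edges keeps the solution in the
transportation polytope `𝒳` and does not increase the LP cost `∑ (f_p / b_q) x_{pq}`. -/
theorem stmt_0
    (n m : ℕ) (hn : 0 < n) (hm : 0 < m)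
    (a : Fin n → ℤ) (ha : ∀ i, 0 < a i)
    (b : Fin m → ℤ) (hb : ∀ j, 0 < b j)
    (hab : ∑ i, a i = ∑ j, b j)
    (f : Fin n → ℝ) (hf0 : ∀ i, 0 ≤ f i)
    (hfmono : ∀ i i' : Fin n, i ≤ i' → f i' ≤ f i)
    (hbmono : ∀ j j' : Fin m, j ≤ j' → b j' ≤ b j)
    (x : Fin n → Fin m → ℝ)
    (hx_nonneg : ∀ i j, 0 ≤ x i j)
    (hx_row : ∀ i, ∑ j, x i j = (a i : ℝ))
    (hx_col : ∀ j, ∑ i, x i j = (b j : ℝ))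
    (i i' : Fin n) (j j' : Fin m) (hii : i < i') (hjj : j < j')
    (h1 : 0 < x i j') (h2 : 0 < x i' j)
    (ε : ℝ) (hε : ε = min (x i j') (x i' j))
    (x' : Fin n → Fin m → ℝ)
    (hx' : ∀ p q, x' p q = x p q
      + (if p = i ∧ q = j then ε else 0)
      + (if p = i' ∧ q = j' then ε else 0)
      - (if p = i ∧ q = j' then ε else 0)
      - (if p = i' ∧ q = j then ε else 0)) :
    ((∀ p q, 0 ≤ x' p q) ∧ (∀ p, ∑ q, x' p q = (a p : ℝ)) ∧
      (∀ q, ∑ p, x' p q = (b q : ℝ))) ∧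
    ∑ p, ∑ q, (f p / (b q : ℝ)) * x' p q ≤ ∑ p, ∑ q, (f p / (b q : ℝ)) * x p q := by
  have hε0 : 0 ≤ ε := hε ▸ (lt_min h1 h2).le
  have hε1 : ε ≤ x i j' := hε ▸ min_le_left _ _
  have hε2 : ε ≤ x i' j := hε ▸ min_le_right _ _
  refine ⟨⟨fun p q => ?_, fun p => ?_, fun q => ?_⟩, ?_⟩
  · have hpq := hx_nonneg p q
    rw [hx']
    by_cases hp : p = i
    · subst hp
      by_cases hq : q = j'
      · subst hq
        simp [hii.ne, hjj.ne', hε1]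
      · simp only [hii.ne, hq, true_and, false_and, and_false, if_false]
        split_ifs <;> linarith
    · by_cases hpq' : p = i' ∧ q = j
      · obtain ⟨rfl, rfl⟩ := hpq'
        simp [hp, hjj.ne, hε2]
      · simp only [hp, hpq', false_and, if_false]
        split_ifs <;> linarith
  · simp only [hx', sum_sub_distrib, sum_add_distrib, hx_row, ite_and]
    simp only [sum_ite_irrel, sum_ite_eq', mem_univ, if_true, sum_const_zero]
    ring
  · simp only [hx', sum_sub_distrib, sum_add_distrib, hx_col, and_comm (b := q = _), ite_and]
    simp only [sum_ite_irrel, sum_ite_eq', mem_univ, if_true, sum_const_zero]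
    ring
  · simp only [hx', mul_sub, mul_add, sum_sub_distrib, sum_add_distrib,
      sum_sum_mul_ite_and_eq (fun p q => f p / (b q : ℝ))]
    have hbj' : (0 : ℝ) < b j' := by exact_mod_cast hb j'
    have hbb : (b j' : ℝ) ≤ b j := by exact_mod_cast hbmono j j' hjj.le
    have hinv : (b j : ℝ)⁻¹ ≤ (b j' : ℝ)⁻¹ := inv_anti₀ hbj' hbb
    have hkey := mul_nonneg (mul_nonneg (sub_nonneg.2 (hfmono i i' hii.le))
      (sub_nonneg.2 hinv)) hε0
    simp only [div_eq_mul_inv]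
    linarith
end

section
/- Assume f_1 ≥ f_2 ≥ … ≥ f_n ≥ 0 and b_1 ≥ b_2 ≥ … ≥ b_m. Then every x ∈ 𝒳 satisfies cost_f(x) ≥ ∑_{i=1}^{n} (f_i − f_{i+1}) · π(a_1 + … + a_i). In particular, the optimum value of the PFCT-S instance is at least ∑_{i=1}^{n} (f_i − f_{i+1}) · π(a_1 + … + a_i). -/
open Finset

/-- Sum of the first `t` entries of a vector indexed by `Fin k`. -/
def partialSum {k : ℕ} (c : Fin k → ℤ) (t : ℕ) : ℤ :=
  ∑ i : Fin k, if (i : ℕ) < t then c i else 0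

/-- `π(t)`: the smallest `j` such that the first `j` sinks have total demand at least `t`. -/
noncomputable def piFn {m : ℕ} (b : Fin m → ℤ) (t : ℝ) : ℕ :=
  sInf {k : ℕ | t ≤ (partialSum b k : ℝ)}

/-- Extension of the cost vector with `f_{n+1} = 0` (0-indexed: `fext f k = f_{k+1}`,
and `fext f k = 0` for `k ≥ n`). -/
noncomputable def fext {n : ℕ} (f : Fin n → ℝ) (k : ℕ) : ℝ :=
  if h : k < n then f ⟨k, h⟩ else 0

/-- PFCT-S cost of a solution `x`: `∑_{(i,j) : x_{ij} > 0} f_i`. -/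
noncomputable def costF {n m : ℕ} (f : Fin n → ℝ) (x : Fin n → Fin m → ℝ) : ℝ :=
  ∑ i : Fin n, ∑ j : Fin m, if 0 < x i j then f i else 0

theorem partialSum_succ {k : ℕ} (c : Fin k → ℤ) {t : ℕ} (h : t < k) :
    partialSum c (t + 1) = partialSum c t + c ⟨t, h⟩ := by
  have hc : c ⟨t, h⟩ = ∑ i : Fin k, if i = ⟨t, h⟩ then c i else 0 := by simp
  rw [hc, partialSum, partialSum, ← Finset.sum_add_distrib]
  refine Finset.sum_congr rfl fun i _ => ?_
  rcases lt_trichotomy (i : ℕ) t with hi | hi | hi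
  · simp [Fin.ext_iff, hi, hi.ne, hi.trans (Nat.lt_succ_self t)]
  · simp [Fin.ext_iff, hi]
  · simp [Fin.ext_iff, hi.not_gt, hi.ne', (Nat.succ_le_of_lt hi).not_gt]

/-- For an antitone vector, the sum over any index set is at most the sum of the first entries,
as many as the index set has elements. -/
theorem sum_le_partialSum_card {m : ℕ} {b : Fin m → ℤ} (hb : Antitone b) (s : Finset (Fin m)) :
    ∑ j ∈ s, b j ≤ partialSum b s.card := by
  induction s using Finset.induction_on_max with
  | empty => simp [partialSum]
  | insert j s hj ih =>
    have hjs : j ∉ s := fun h => lt_irrefl _ (hj j h)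
    have hcard : s.card ≤ (j : ℕ) := by
      have := Finset.card_le_card (fun i hi => Finset.mem_Iio.2 (hj i hi) : s ⊆ Finset.Iio j)
      rwa [Fin.card_Iio] at this
    rw [Finset.sum_insert hjs, Finset.card_insert_of_notMem hjs,
      partialSum_succ b (hcard.trans_lt j.isLt), add_comm]
    exact add_le_add ih (hb hcard)

/-- The number of positive entries in the first `t` rows of a feasible solution is at least `π` of
the total supply of these rows. -/
theorem piFn_partialSum_le_partialSum_card {n m : ℕ} {a : Fin n → ℤ} {b : Fin m → ℤ}
    (hb : Antitone b) {x : Fin n → Fin m → ℝ} (hx : ∀ i j, 0 ≤ x i j)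
    (hrow : ∀ i, ∑ j, x i j = (a i : ℝ)) (hcol : ∀ j, ∑ i, x i j = (b j : ℝ)) (t : ℕ) :
    (piFn b (partialSum a t : ℝ) : ℤ) ≤
      partialSum (fun i => ((Finset.univ.filter fun j => 0 < x i j).card : ℤ)) t := by
  classical
  set s : Finset (Fin m) := (Finset.univ.filter fun i : Fin n => (i : ℕ) < t).biUnion
    fun i => Finset.univ.filter fun j => 0 < x i j
  have hcard : (s.card : ℤ) ≤
      partialSum (fun i => ((Finset.univ.filter fun j => 0 < x i j).card : ℤ)) t := by
    rw [partialSum, ← Finset.sum_filter]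
    exact_mod_cast Finset.card_biUnion_le
  refine le_trans ?_ hcard
  have hsupply : (partialSum a t : ℝ) ≤ ∑ j ∈ s, (b j : ℝ) := by
    calc (partialSum a t : ℝ)
        = ∑ i ∈ Finset.univ.filter (fun i : Fin n => (i : ℕ) < t), ∑ j, x i j := by
          rw [partialSum, ← Finset.sum_filter]
          push_cast
          exact Finset.sum_congr rfl fun i _ => (hrow i).symm
      _ = ∑ i ∈ Finset.univ.filter (fun i : Fin n => (i : ℕ) < t), ∑ j ∈ s, x i j := by
          refine Finset.sum_congr rfl fun i hi => ?_
          refine (Finset.sum_subset (Finset.subset_univ s) fun j _ hj => ?_).symm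
          by_contra hne
          exact hj (Finset.mem_biUnion.2 ⟨i, hi, by
            simpa using lt_of_le_of_ne (hx i j) (Ne.symm hne)⟩)
      _ ≤ ∑ i, ∑ j ∈ s, x i j :=
          Finset.sum_le_sum_of_subset_of_nonneg (Finset.subset_univ _)
            fun i _ _ => Finset.sum_nonneg fun j _ => hx i j
      _ = ∑ j ∈ s, (b j : ℝ) := by
          rw [Finset.sum_comm]
          exact Finset.sum_congr rfl fun j _ => hcol j
  exact_mod_cast Nat.sInf_le (hsupply.trans (by exact_mod_cast sum_le_partialSum_card hb s))

/-- Summation by parts for the extended vector. -/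
theorem sum_fext_sub_mul_partialSum {n : ℕ} (f : Fin n → ℝ) (d : Fin n → ℤ) :
    ∑ i ∈ Finset.range n, (fext f i - fext f (i + 1)) * (partialSum d (i + 1) : ℝ) =
      ∑ i, f i * (d i : ℝ) := by
  have key : ∀ N ≤ n,
      ∑ i ∈ Finset.range N, (fext f i - fext f (i + 1)) * (partialSum d (i + 1) : ℝ)
        + fext f N * (partialSum d N : ℝ) =
      ∑ i ∈ Finset.range N, fext f i * (if h : i < n then (d ⟨i, h⟩ : ℝ) else 0) := by
    intro N
    induction N with
    | zero => simp [partialSum]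
    | succ N ih =>
      intro hN
      rw [Finset.sum_range_succ, Finset.sum_range_succ, ← ih (Nat.le_of_succ_le hN),
        dif_pos (Nat.lt_of_succ_le hN), partialSum_succ d (Nat.lt_of_succ_le hN)]
      push_cast
      ring
  have hn := key n le_rfl
  rw [Finset.sum_range fun i => fext f i * (if h : i < n then (d ⟨i, h⟩ : ℝ) else 0)] at hn
  simpa [fext] using hn

theorem fext_succ_le {n : ℕ} {f : Fin n → ℝ} (hf0 : ∀ i, 0 ≤ f i) (hf : Antitone f) (i : ℕ) :
    fext f (i + 1) ≤ fext f i := by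
  unfold fext
  split_ifs with h1 h2 h2
  · exact hf (Nat.le_succ i)
  · omega
  · exact hf0 _
  · exact le_rfl

/-- every `x ∈ 𝒳` satisfies
`cost_f(x) ≥ ∑_{i=1}^{n} (f_i − f_{i+1}) · π(a_1 + … + a_i)`; in particular this lower
bounds the optimum value of the PFCT-S instance. -/
theorem stmt_1
    (n m : ℕ) (hn : 0 < n) (hm : 0 < m)
    (a : Fin n → ℤ) (ha : ∀ i, 0 < a i)
    (b : Fin m → ℤ) (hb : ∀ j, 0 < b j)
    (hab : ∑ i, a i = ∑ j, b j)
    (f : Fin n → ℝ) (hf0 : ∀ i, 0 ≤ f i)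
    (hfmono : ∀ i i' : Fin n, i ≤ i' → f i' ≤ f i)
    (hbmono : ∀ j j' : Fin m, j ≤ j' → b j' ≤ b j)
    (x : Fin n → Fin m → ℝ)
    (hx_nonneg : ∀ i j, 0 ≤ x i j)
    (hx_row : ∀ i, ∑ j, x i j = (a i : ℝ))
    (hx_col : ∀ j, ∑ i, x i j = (b j : ℝ)) :
    ∑ i ∈ Finset.range n,
        (fext f i - fext f (i + 1)) * (piFn b ((partialSum a (i + 1) : ℤ) : ℝ) : ℝ)
      ≤ costF f x := by
  have hcost : costF f x =
      ∑ i, f i * (((Finset.univ.filter fun j => 0 < x i j).card : ℤ) : ℝ) := by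
    refine Finset.sum_congr rfl fun i _ => ?_
    rw [← Finset.sum_filter, Finset.sum_const, nsmul_eq_mul, mul_comm, Int.cast_natCast]
  rw [hcost, ← sum_fext_sub_mul_partialSum]
  refine Finset.sum_le_sum fun i _ => mul_le_mul_of_nonneg_left ?_
    (sub_nonneg.2 (fext_succ_le hf0 hfmono i))
  exact_mod_cast piFn_partialSum_le_partialSum_card hbmono hx_nonneg hx_row hx_col (i + 1)
end

section
/- Let c ∈ ℝ_{≥0}^{[n]×[m]} and suppose x ∈ 𝒳 minimizes the linear cost ∑_{i,j} c_{ij} x_{ij} over 𝒳 and the bipartite graph with edge set supp(x) contains no cycle. Then for every y ∈ 𝒳, |supp(x)| + ∑_{i,j} c_{ij} x_{ij} ≤ 2 · (|supp(y)| + ∑_{i,j} c_{ij} y_{ij}). That is, such an x is a 2-approximate solution to the Fixed Charge Transportation problem with Uniform Fixed Costs (FCT-U), in which the total cost of y ∈ 𝒳 is the number of support edges |supp(y)| plus the linear cost ∑_{i,j} c_{ij} y_{ij}. -/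
open Finset

/-- The bipartite (simple) graph on `[n] ⊔ [m]` whose edges are the support pairs of `x`. -/
def suppGraph {n m : ℕ} (x : Fin n → Fin m → ℝ) : SimpleGraph (Fin n ⊕ Fin m) :=
  SimpleGraph.fromRel (fun u v => ∃ i j, u = Sum.inl i ∧ v = Sum.inr j ∧ 0 < x i j)

theorem SimpleGraph.IsAcyclic.card_edgeFinset_lt {V : Type*} [Fintype V] [Nonempty V]
    {G : SimpleGraph V} [Fintype G.edgeSet] (hG : G.IsAcyclic) :
    #G.edgeFinset < Fintype.card V := by
  classical
  obtain ⟨T, hGT, -, hT⟩ :=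
    (SimpleGraph.connected_top (V := V)).exists_isTree_le_of_le_of_isAcyclic le_top hG
  have hcard := hT.card_edgeFinset
  have hle := card_le_card (SimpleGraph.edgeFinset_mono hGT)
  omega

theorem suppGraph_adj_inl_inr {n m : ℕ} {x : Fin n → Fin m → ℝ} {i : Fin n} {j : Fin m} :
    (suppGraph x).Adj (Sum.inl i) (Sum.inr j) ↔ 0 < x i j := by
  simp [suppGraph]

/-- A matrix whose support is a forest has at most `n + m` support entries. -/
theorem card_supp_le_of_isAcyclic {n m : ℕ} {x : Fin n → Fin m → ℝ} (hn : 0 < n)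
    (hx : (suppGraph x).IsAcyclic) :
    #{p : Fin n × Fin m | 0 < x p.1 p.2} ≤ n + m := by
  classical
  have : Nonempty (Fin n ⊕ Fin m) := ⟨Sum.inl ⟨0, hn⟩⟩
  have hlt := hx.card_edgeFinset_lt
  have hle : #{p : Fin n × Fin m | 0 < x p.1 p.2} ≤ #(suppGraph x).edgeFinset := by
    refine card_le_card_of_injOn (fun p => s(Sum.inl p.1, Sum.inr p.2)) ?_ ?_
    · intro p hp
      simpa [suppGraph_adj_inl_inr] using hp
    · rintro ⟨i, j⟩ - ⟨i', j'⟩ - h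
      simpa using h
  simp only [Fintype.card_sum, Fintype.card_fin] at hlt
  omega

/-- If every row sum is positive, then there are at least as many support entries as rows. -/
theorem card_rows_le_card_supp {ι κ : Type*} [Fintype ι] [Fintype κ] {y : ι → κ → ℝ}
    (hy : ∀ i, 0 < ∑ j, y i j) :
    Fintype.card ι ≤ #{p : ι × κ | 0 < y p.1 p.2} := by
  have hpos : ∀ i, ∃ j, 0 < y i j := fun i => by
    obtain ⟨j, -, hj⟩ := exists_lt_of_sum_lt (f := fun _ => (0 : ℝ)) (by simpa using hy i)
    exact ⟨j, hj⟩
  choose f hf using hpos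
  refine card_le_card_of_injOn (s := univ) (fun i => (i, f i)) (fun i _ => by simp [hf]) ?_
  intro i _ i' _ h
  exact congrArg Prod.fst h

/-- If every column sum is positive, then there are at least as many support entries as columns. -/
theorem card_cols_le_card_supp {ι κ : Type*} [Fintype ι] [Fintype κ] {y : ι → κ → ℝ}
    (hy : ∀ j, 0 < ∑ i, y i j) :
    Fintype.card κ ≤ #{p : ι × κ | 0 < y p.1 p.2} := by
  refine (card_rows_le_card_supp (y := fun j i => y i j) hy).trans
    (card_le_card_of_injOn Prod.swap ?_ Prod.swap_injective.injOn)
  intro p hp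
  simpa using hp

/-- if `x ∈ 𝒳` minimizes the linear cost over `𝒳` and its support is a
forest, then `x` is a 2-approximate solution for FCT-U: for every `y ∈ 𝒳`,
`|supp(x)| + ∑ c_{ij} x_{ij} ≤ 2 (|supp(y)| + ∑ c_{ij} y_{ij})`. -/
theorem stmt_7
    (n m : ℕ) (hn : 0 < n) (hm : 0 < m)
    (a : Fin n → ℤ) (ha : ∀ i, 0 < a i)
    (b : Fin m → ℤ) (hb : ∀ j, 0 < b j)
    (hab : ∑ i, a i = ∑ j, b j)
    (c : Fin n → Fin m → ℝ) (hc : ∀ i j, 0 ≤ c i j)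
    (x : Fin n → Fin m → ℝ)
    (hx_nonneg : ∀ i j, 0 ≤ x i j)
    (hx_row : ∀ i, ∑ j, x i j = (a i : ℝ))
    (hx_col : ∀ j, ∑ i, x i j = (b j : ℝ))
    (hx_min : ∀ z : Fin n → Fin m → ℝ,
      (∀ i j, 0 ≤ z i j) → (∀ i, ∑ j, z i j = (a i : ℝ)) → (∀ j, ∑ i, z i j = (b j : ℝ)) →
      ∑ i, ∑ j, c i j * x i j ≤ ∑ i, ∑ j, c i j * z i j)
    (hx_forest : (suppGraph x).IsAcyclic)
    (y : Fin n → Fin m → ℝ)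
    (hy_nonneg : ∀ i j, 0 ≤ y i j)
    (hy_row : ∀ i, ∑ j, y i j = (a i : ℝ))
    (hy_col : ∀ j, ∑ i, y i j = (b j : ℝ)) :
    ((Finset.univ.filter (fun p : Fin n × Fin m => 0 < x p.1 p.2)).card : ℝ)
        + ∑ i, ∑ j, c i j * x i j
      ≤ 2 * (((Finset.univ.filter (fun p : Fin n × Fin m => 0 < y p.1 p.2)).card : ℝ)
        + ∑ i, ∑ j, c i j * y i j) := by
  have hsx := card_supp_le_of_isAcyclic hn hx_forest
  have hrows := card_rows_le_card_supp (y := y) fun i => by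
    rw [hy_row]; exact_mod_cast ha i
  have hcols := card_cols_le_card_supp (y := y) fun j => by
    rw [hy_col]; exact_mod_cast hb j
  rw [Fintype.card_fin] at hrows hcols
  have hcard : (#{p : Fin n × Fin m | 0 < x p.1 p.2} : ℝ)
      ≤ 2 * #{p : Fin n × Fin m | 0 < y p.1 p.2} := by
    exact_mod_cast (by omega)
  have hcost := hx_min y hy_nonneg hy_row hy_col
  have hcost_nonneg : 0 ≤ ∑ i, ∑ j, c i j * y i j :=
    sum_nonneg fun i _ => sum_nonneg fun j _ => mul_nonneg (hc i j) (hy_nonneg i j)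
  linarith
end

section
/- The minimum of |supp(x)| over all x ∈ 𝒳 equals n + m − K, where K is the maximum number of parts over all partitions of [n] ⊔ [m] into balanced sets. Equivalently, the optimum cost of a Pure Fixed Charge Transportation instance with Uniform Fixed Costs (PFCT-U) equals n + m minus the maximum number of balanced sets into which the sources and sinks can be partitioned. -/
open Finset

/-- The transportation problem with supplies `a` on `S` and demands `b` on `T` has a feasible
solution with fewer than `#S + #T` positive entries. -/
def HasSparseTransport {α β : Type*} (S : Finset α) (T : Finset β) (a : α → ℝ) (b : β → ℝ) :
    Prop :=
  ∃ x : α → β → ℝ, (∀ i j, 0 ≤ x i j) ∧ (∀ i ∈ S, ∑ j ∈ T, x i j = a i) ∧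
    (∀ j ∈ T, ∑ i ∈ S, x i j = b j) ∧ #{p ∈ S ×ˢ T | 0 < x p.1 p.2} + 1 ≤ #S + #T

theorem HasSparseTransport.swap {α β : Type*} {S : Finset α} {T : Finset β} {a : α → ℝ}
    {b : β → ℝ} (h : HasSparseTransport S T a b) : HasSparseTransport T S b a := by
  obtain ⟨x, h0, h1, h2, h3⟩ := h
  refine ⟨fun j i => x i j, fun j i => h0 i j, h2, h1, ?_⟩
  have : #{p ∈ T ×ˢ S | 0 < x p.2 p.1} ≤ #{p ∈ S ×ˢ T | 0 < x p.1 p.2} := by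
    refine card_le_card_of_injOn Prod.swap ?_ Prod.swap_injective.injOn
    rintro ⟨j, i⟩ hp
    simp only [coe_filter, mem_product, Set.mem_ofPred_eq, Prod.swap_prod_mk] at hp ⊢
    tauto
  dsimp only
  omega

/-- Ship the whole supply of `i` to `j`. -/
theorem HasSparseTransport.of_erase {α β : Type*} [DecidableEq α] [DecidableEq β] {S : Finset α}
    {T : Finset β} {a : α → ℝ} {b : β → ℝ} {i : α} {j : β} (hi : i ∈ S) (hj : j ∈ T)
    (hai : 0 ≤ a i)
    (h : HasSparseTransport (S.erase i) T a (Function.update b j (b j - a i))) :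
    HasSparseTransport S T a b := by
  obtain ⟨x, h0, h1, h2, h3⟩ := h
  refine ⟨fun i' j' => if i' = i then (if j' = j then a i else 0) else x i' j', ?_, ?_, ?_, ?_⟩
  · intro i' j'
    dsimp only
    split_ifs
    exacts [hai, le_rfl, h0 _ _]
  · intro i' hi'
    by_cases h : i' = i
    · subst h
      simp [hj]
    · simp [h, h1 i' (mem_erase.2 ⟨h, hi'⟩)]
  · intro j' hj'
    rw [← add_sum_erase S _ hi, sum_congr rfl (g := fun i' => x i' j'), h2 j' hj']
    · by_cases h : j' = j
      · subst h
        simp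
      · simp [h]
    · intro i' hi'
      simp [(mem_erase.1 hi').1]
  · have hsub : {p ∈ S ×ˢ T | 0 < if p.1 = i then (if p.2 = j then a i else 0) else x p.1 p.2} ⊆
        insert (i, j) {p ∈ (S.erase i) ×ˢ T | 0 < x p.1 p.2} := by
      rintro ⟨i', j'⟩ hp
      simp only [mem_filter, mem_product, mem_insert, mem_erase, Prod.mk.injEq] at hp ⊢
      by_cases h : i' = i
      · by_cases h' : j' = j
        · exact Or.inl ⟨h, h'⟩
        · simp [h, h'] at hp
      · simp only [h, if_false] at hp
        tauto
    have := (card_le_card hsub).trans (card_insert_le _ _)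
    have := card_erase_add_one hi
    dsimp only
    omega

theorem hasSparseTransport_of_left_eq_empty {α β : Type*} {S : Finset α} {T : Finset β}
    {a : α → ℝ} {b : β → ℝ} (hS : S = ∅) (hb : ∀ j ∈ T, 0 ≤ b j)
    (hab : ∑ i ∈ S, a i = ∑ j ∈ T, b j) (hT : T.Nonempty) : HasSparseTransport S T a b := by
  subst hS
  rw [sum_empty, eq_comm, sum_eq_zero_iff_of_nonneg hb] at hab
  exact ⟨0, by simp, by simp, by simpa using fun j hj => (hab j hj).symm, by simpa using hT⟩

theorem hasSparseTransport {α β : Type*} (S : Finset α) (T : Finset β) (a : α → ℝ)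
    (b : β → ℝ) (ha : ∀ i ∈ S, 0 ≤ a i) (hb : ∀ j ∈ T, 0 ≤ b j)
    (hab : ∑ i ∈ S, a i = ∑ j ∈ T, b j) (hne : 0 < #S + #T) : HasSparseTransport S T a b := by
  classical
  induction hN : #S + #T generalizing S T a b with
  | zero => omega
  | succ N ih =>
    rcases S.eq_empty_or_nonempty with hS | ⟨i, hi⟩
    · exact hasSparseTransport_of_left_eq_empty hS hb hab
        (card_pos.1 (by simpa [hS] using hne))
    rcases T.eq_empty_or_nonempty with hT | ⟨j, hj⟩
    · exact (hasSparseTransport_of_left_eq_empty hT ha hab.symm ⟨i, hi⟩).swap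
    have hSi := card_erase_add_one hi
    have hTj := card_erase_add_one hj
    have hS0 := card_pos.2 ⟨i, hi⟩
    have hT0 := card_pos.2 ⟨j, hj⟩
    have hsS := add_sum_erase S a hi
    have hsT := add_sum_erase T b hj
    rcases le_total (a i) (b j) with h | h
    · refine .of_erase hi hj (ha i hi) (ih _ _ _ _ (fun k hk => ha k (mem_of_mem_erase hk)) ?_ ?_
        (by omega) (by omega))
      · intro k hk
        by_cases hkj : k = j
        · subst hkj
          simpa using h
        · simpa [hkj] using hb k hk
      · rw [sum_update_of_mem hj, ← erase_eq]
        linarith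
    · refine .swap (.of_erase hj hi (hb j hj) (.swap (ih _ _ _ _ ?_
        (fun k hk => hb k (mem_of_mem_erase hk)) ?_ (by omega) (by omega))))
      · intro k hk
        by_cases hki : k = i
        · subst hki
          simpa using h
        · simpa [hki] using ha k hk
      · rw [sum_update_of_mem hi, ← erase_eq]
        linarith

/-- A labelling constant along the edges in `E` can take at least `card V - #E` values. -/
theorem exists_labelling_card_le {V : Type*} [Fintype V] [DecidableEq V] (E : Finset (V × V)) :
    ∃ f : V → V, (∀ p ∈ E, f p.1 = f p.2) ∧ Fintype.card V ≤ #(univ.image f) + #E := by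
  induction E using Finset.induction_on with
  | empty => exact ⟨id, by simp⟩
  | insert e E he ih =>
    obtain ⟨f, hf, hc⟩ := ih
    refine ⟨fun w => if f w = f e.2 then f e.1 else f w, ?_, ?_⟩
    · intro p hp
      rcases mem_insert.1 hp with rfl | hp
      · simp
      · simp only [hf p hp]
    · have hsub : (univ.image f).erase (f e.2) ⊆
          univ.image (fun w => if f w = f e.2 then f e.1 else f w) := by
        intro c hcm
        obtain ⟨hne, hcm⟩ := mem_erase.1 hcm
        obtain ⟨w, -, rfl⟩ := mem_image.1 hcm
        exact mem_image.2 ⟨w, mem_univ _, by simp [hne]⟩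
      have h1 := card_le_card hsub
      have h2 := card_erase_add_one (mem_image_of_mem f (mem_univ e.2))
      rw [card_insert_of_notMem he]
      omega

/-- A partition of sources and sinks into balanced sets. -/
def IsBalancedPartition {n m : ℕ} (a : Fin n → ℤ) (b : Fin m → ℤ)
    (P : Finset (Finset (Fin n ⊕ Fin m))) : Prop :=
  (∀ U ∈ P, U.Nonempty) ∧
  (∀ U ∈ P, ∑ u ∈ U, Sum.elim a (fun j => -(b j)) u = 0) ∧
  (∀ U ∈ P, ∀ V ∈ P, U ≠ V → Disjoint U V) ∧
  (∀ v : Fin n ⊕ Fin m, ∃ U ∈ P, v ∈ U)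

/-- Each feasible `x` yields a balanced partition with at least `n + m - |supp x|` parts. -/
theorem exists_isBalancedPartition_of_transport {n m : ℕ} (a : Fin n → ℤ) (b : Fin m → ℤ)
    (x : Fin n → Fin m → ℝ) (h0 : ∀ i j, 0 ≤ x i j) (h1 : ∀ i, ∑ j, x i j = (a i : ℝ))
    (h2 : ∀ j, ∑ i, x i j = (b j : ℝ)) :
    ∃ P, IsBalancedPartition a b P ∧
      n + m ≤ #P + #(univ.filter (fun p : Fin n × Fin m => 0 < x p.1 p.2)) := by
  obtain ⟨f, hf, hc⟩ := exists_labelling_card_le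
    ((univ.filter (fun p : Fin n × Fin m => 0 < x p.1 p.2)).image
      fun p => ((Sum.inl p.1 : Fin n ⊕ Fin m), (Sum.inr p.2 : Fin n ⊕ Fin m)))
  have hf' : ∀ i j, x i j ≠ 0 → f (Sum.inl i) = f (Sum.inr j) := fun i j hij =>
    hf (Sum.inl i, Sum.inr j) (mem_image.2 ⟨(i, j), by simpa using (h0 i j).lt_of_ne' hij, rfl⟩)
  refine ⟨(univ.image f).image fun c => univ.filter (f · = c), ⟨?_, ?_, ?_, ?_⟩, ?_⟩
  · simp only [mem_image, mem_univ, true_and, exists_exists_eq_and, forall_exists_index,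
      forall_apply_eq_imp_iff]
    exact fun v => ⟨v, by simp⟩
  · simp only [mem_image, mem_univ, true_and, exists_exists_eq_and, forall_exists_index,
      forall_apply_eq_imp_iff]
    intro v
    have key : ∑ i, (if f (Sum.inl i) = f v then (a i : ℝ) else 0) =
        ∑ j, (if f (Sum.inr j) = f v then (b j : ℝ) else 0) := by
      simp only [← h1, ← h2]
      have e1 : ∀ i, (if f (Sum.inl i) = f v then ∑ j, x i j else 0) =
          ∑ j, if f (Sum.inl i) = f v then x i j else 0 := fun i => by split_ifs <;> simp
      have e2 : ∀ j, (if f (Sum.inr j) = f v then ∑ i, x i j else 0) =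
          ∑ i, if f (Sum.inr j) = f v then x i j else 0 := fun j => by split_ifs <;> simp
      rw [sum_congr rfl fun i _ => e1 i, sum_congr rfl fun j _ => e2 j, sum_comm]
      refine sum_congr rfl fun j _ => sum_congr rfl fun i _ => ?_
      by_cases hij : x i j = 0
      · simp [hij]
      · rw [hf' i j hij]
    rw [sum_filter, Fintype.sum_sum_type]
    simp only [Sum.elim_inl, Sum.elim_inr]
    have key' : ∑ i, (if f (Sum.inl i) = f v then a i else 0) =
        ∑ j, (if f (Sum.inr j) = f v then b j else 0) := by exact_mod_cast key
    rw [key', ← sum_add_distrib]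
    exact sum_eq_zero fun j _ => by split_ifs <;> simp
  · simp only [mem_image, mem_univ, true_and, exists_exists_eq_and, forall_exists_index,
      forall_apply_eq_imp_iff]
    intro v w hvw
    refine disjoint_filter.2 fun u _ hu hu' => hvw ?_
    rw [← hu, ← hu']
  · exact fun v => ⟨univ.filter (f · = f v), mem_image_of_mem _ (mem_image_of_mem _ (mem_univ v)),
      by simp⟩
  · rw [card_image_of_injOn]
    · have := card_image_le (s := univ.filter (fun p : Fin n × Fin m => 0 < x p.1 p.2))
        (f := fun p => ((Sum.inl p.1 : Fin n ⊕ Fin m), (Sum.inr p.2 : Fin n ⊕ Fin m)))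
      simp only [Fintype.card_sum, Fintype.card_fin] at hc
      omega
    · intro c hcm d _ hcd
      obtain ⟨v, -, rfl⟩ := mem_image.1 (mem_coe.1 hcm)
      have : v ∈ univ.filter (f · = d) := by
        simp only at hcd
        rw [← hcd]
        simp
      simpa using this

/-- A balanced partition yields a feasible `x` with `|supp x| ≤ n + m - #P`. -/
theorem IsBalancedPartition.exists_transport {n m : ℕ} {a : Fin n → ℤ} (ha : ∀ i, 0 < a i)
    {b : Fin m → ℤ} (hb : ∀ j, 0 < b j) {P : Finset (Finset (Fin n ⊕ Fin m))}
    (hP : IsBalancedPartition a b P) :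
    ∃ x : Fin n → Fin m → ℝ, (∀ i j, 0 ≤ x i j) ∧ (∀ i, ∑ j, x i j = (a i : ℝ)) ∧
      (∀ j, ∑ i, x i j = (b j : ℝ)) ∧
      #(univ.filter (fun p : Fin n × Fin m => 0 < x p.1 p.2)) + #P ≤ n + m := by
  obtain ⟨hne, hbal, hdisj, hcov⟩ := hP
  have hsparse : ∀ U ∈ P, HasSparseTransport U.toLeft U.toRight
      (fun i => (a i : ℝ)) (fun j => (b j : ℝ)) := by
    intro U hU
    refine hasSparseTransport _ _ _ _ (fun i _ => by exact_mod_cast (ha i).le)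
      (fun j _ => by exact_mod_cast (hb j).le) ?_ ?_
    · have := hbal U hU
      rw [← toLeft_disjSum_toRight (u := U), sum_disjSum] at this
      simp only [Sum.elim_inl, Sum.elim_inr, sum_neg_distrib] at this
      have : ∑ i ∈ U.toLeft, a i = ∑ j ∈ U.toRight, b j := by linarith
      exact_mod_cast this
    · rw [card_toLeft_add_card_toRight]
      exact card_pos.2 (hne U hU)
  choose! y hy0 hy1 hy2 hy3 using hsparse
  choose p hpP hp using hcov
  have hp_iff : ∀ U ∈ P, ∀ v, p v = U ↔ v ∈ U := fun U hU v =>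
    ⟨fun h => h ▸ hp v, fun h => by
      by_contra hne'
      exact disjoint_left.1 (hdisj _ (hpP v) _ hU hne') (hp v) h⟩
  refine ⟨fun i j => if p (Sum.inl i) = p (Sum.inr j) then y (p (Sum.inl i)) i j else 0,
    ?_, ?_, ?_, ?_⟩
  · intro i j
    dsimp only
    split_ifs
    exacts [hy0 _ (hpP _) _ _, le_rfl]
  · intro i
    refine Eq.trans ?_ (hy1 _ (hpP (Sum.inl i)) i (mem_toLeft.2 (hp _)))
    rw [← sum_filter]
    refine sum_congr ?_ fun _ _ => rfl
    ext j
    rw [mem_filter, mem_toRight, ← hp_iff _ (hpP _), eq_comm]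
    simp
  · intro j
    refine Eq.trans ?_ (hy2 _ (hpP (Sum.inr j)) j (mem_toRight.2 (hp _)))
    rw [← sum_filter]
    refine sum_congr ?_ fun i hi => ?_
    · ext i
      rw [mem_filter, mem_toLeft, ← hp_iff _ (hpP _)]
      simp
    · rw [(hp_iff _ (hpP _) _).2 (mem_toLeft.1 hi)]
  · set X : Finset (Fin n × Fin m) := _
    change #X + #P ≤ n + m
    have hX : #X ≤ ∑ U ∈ P, #{q ∈ U.toLeft ×ˢ U.toRight | 0 < y U q.1 q.2} := by
      refine le_trans (card_le_card ?_) card_biUnion_le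
      rintro ⟨i, j⟩ hq
      have hq : 0 < if p (Sum.inl i) = p (Sum.inr j) then y (p (Sum.inl i)) i j else 0 := by
        simpa [X] using hq
      split_ifs at hq with h
      · refine mem_biUnion.2 ⟨p (Sum.inl i), hpP _, mem_filter.2 ⟨mem_product.2 ⟨?_, ?_⟩, hq⟩⟩
        · exact mem_toLeft.2 (hp _)
        · exact mem_toRight.2 (h ▸ hp _)
      · exact absurd hq (lt_irrefl _)
    have hV : ∑ U ∈ P, #U = n + m := by
      have hcard := card_biUnion (t := id) (fun U hU V hV h => hdisj U hU V hV h)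
      have huniv : P.biUnion id = univ :=
        eq_univ_of_forall fun v => mem_biUnion.2 ⟨p v, hpP v, hp v⟩
      rw [huniv] at hcard
      simpa using hcard.symm
    calc #X + #P ≤ ∑ U ∈ P, (#{q ∈ U.toLeft ×ˢ U.toRight | 0 < y U q.1 q.2} + 1) := by
          rw [sum_add_distrib, sum_const, smul_eq_mul, mul_one]
          omega
      _ ≤ ∑ U ∈ P, #U := sum_le_sum fun U hU => by
          rw [← card_toLeft_add_card_toRight (u := U)]
          exact hy3 U hU
      _ = n + m := hV

/-- the minimum support size over `x ∈ 𝒳` (the optimum PFCT-U cost) equals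
`n + m − K`, where `K` is the maximum number of parts over all partitions of `[n] ⊔ [m]`
into (nonempty) balanced sets. -/
theorem stmt_8
    (n m : ℕ) (hn : 0 < n) (hm : 0 < m)
    (a : Fin n → ℤ) (ha : ∀ i, 0 < a i)
    (b : Fin m → ℤ) (hb : ∀ j, 0 < b j)
    (hab : ∑ i, a i = ∑ j, b j)
    (K : ℕ)
    (hK : IsGreatest {k : ℕ | ∃ P : Finset (Finset (Fin n ⊕ Fin m)),
      (∀ U ∈ P, U.Nonempty) ∧
      (∀ U ∈ P, ∑ u ∈ U, Sum.elim a (fun j => -(b j)) u = 0) ∧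
      (∀ U ∈ P, ∀ V ∈ P, U ≠ V → Disjoint U V) ∧
      (∀ v : Fin n ⊕ Fin m, ∃ U ∈ P, v ∈ U) ∧
      P.card = k} K) :
    IsLeast {cst : ℕ | ∃ x : Fin n → Fin m → ℝ,
      (∀ i j, 0 ≤ x i j) ∧ (∀ i, ∑ j, x i j = (a i : ℝ)) ∧
      (∀ j, ∑ i, x i j = (b j : ℝ)) ∧
      (Finset.univ.filter (fun p : Fin n × Fin m => 0 < x p.1 p.2)).card = cst}
      (n + m - K) := by
  have lower : ∀ x : Fin n → Fin m → ℝ, (∀ i j, 0 ≤ x i j) → (∀ i, ∑ j, x i j = (a i : ℝ)) →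
      (∀ j, ∑ i, x i j = (b j : ℝ)) →
      n + m ≤ K + #(univ.filter (fun p : Fin n × Fin m => 0 < x p.1 p.2)) := by
    intro x h0 h1 h2
    obtain ⟨P, ⟨p1, p2, p3, p4⟩, hc⟩ := exists_isBalancedPartition_of_transport a b x h0 h1 h2
    have := hK.2 ⟨P, p1, p2, p3, p4, rfl⟩
    omega
  constructor
  · obtain ⟨P, p1, p2, p3, p4, hPK⟩ := hK.1
    obtain ⟨x, h0, h1, h2, h3⟩ :=
      IsBalancedPartition.exists_transport ha hb (P := P) ⟨p1, p2, p3, p4⟩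
    have := lower x h0 h1 h2
    exact ⟨x, h0, h1, h2, by omega⟩
  · rintro _ ⟨x, h0, h1, h2, rfl⟩
    have := lower x h0 h1 h2
    omega
end

section
/- Let V be a finite nonempty set, B' a positive integer, and Δ := 2(2|V| + 1)^{B'}. Suppose (b_v)_{v ∈ V} are independent random variables, each uniformly distributed on the integer interval {Δ+1, Δ+2, …, 2Δ}. Then with probability at least 1/2, the following event holds: for every h ∈ ℤ^V with 1 ≤ ∑_{v ∈ V} |h_v| ≤ B', we have ∑_{v ∈ V} h_v b_v ≠ 0. -/
open Finset
open Classical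

/-- The integer points of the `ℓ₁` ball of radius `B` in `ℤ^V` lie in a finite set of at most
`(2|V| + 1) ^ B` elements. -/
theorem exists_finset_l1_ball_card_le (V : Type*) [Fintype V] [DecidableEq V] (B : ℕ) :
    ∃ S : Finset (V → ℤ), S.card ≤ (2 * Fintype.card V + 1) ^ B ∧
      ∀ h : V → ℤ, ∑ v, |h v| ≤ (B : ℤ) → h ∈ S := by
  induction B with
  | zero =>
    refine ⟨{0}, by simp, fun h hh => ?_⟩
    have h0 : ∑ v, |h v| = 0 :=
      le_antisymm (by simpa using hh) (Finset.sum_nonneg fun v _ => abs_nonneg _)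
    rw [Finset.sum_eq_zero_iff_of_nonneg fun v _ => abs_nonneg _] at h0
    rw [Finset.mem_singleton]
    funext v
    simpa using h0 v (Finset.mem_univ v)
  | succ B ih =>
    obtain ⟨S, hS, hmem⟩ := ih
    let T : Finset (V → ℤ) := insert 0
      ((Finset.univ.image fun v => Pi.single v (1 : ℤ)) ∪
        Finset.univ.image fun v => Pi.single v (-1 : ℤ))
    have hT : T.card ≤ 2 * Fintype.card V + 1 := by
      refine (Finset.card_insert_le _ _).trans (Nat.succ_le_succ ?_)
      refine (Finset.card_union_le _ _).trans ?_
      rw [two_mul]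
      exact add_le_add Finset.card_image_le Finset.card_image_le
    refine ⟨Finset.image₂ (fun x y => x + y) S T, ?_, fun h hh => ?_⟩
    · rw [pow_succ]
      exact (Finset.card_image₂_le _ _ _).trans (Nat.mul_le_mul hS hT)
    · rw [Finset.mem_image₂]
      by_cases h0 : h = 0
      · subst h0
        exact ⟨0, hmem 0 (by simp), 0, by simp [T], by simp⟩
      · obtain ⟨v, hv⟩ := Function.ne_iff.mp h0
        have hv : h v ≠ 0 := hv
        obtain ⟨c, hc, hcv⟩ : ∃ c : ℤ, (c = 1 ∨ c = -1) ∧ |h v - c| < |h v| := by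
          rcases lt_or_gt_of_ne hv with hneg | hpos
          · exact ⟨-1, Or.inr rfl, by grind⟩
          · exact ⟨1, Or.inl rfl, by grind⟩
        refine ⟨h - Pi.single v c, hmem _ ?_, Pi.single v c, ?_, by simp⟩
        · have hlt : ∑ w, |(h - Pi.single v c : V → ℤ) w| < ∑ w, |h w| := by
            refine Finset.sum_lt_sum (fun w _ => ?_) ⟨v, Finset.mem_univ v, by simpa using hcv⟩
            by_cases hw : w = v
            · subst hw
              simpa using hcv.le
            · simp [hw]
          push_cast at hh
          omega
        · rcases hc with rfl | rfl <;> simp [T]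

/-- A nontrivial linear equation has at most `|s| ^ (|V| - 1)` solutions in the box `s^V`. -/
theorem card_filter_linear_eq_zero_le {V : Type*} [Fintype V] [DecidableEq V]
    (s : Finset ℤ) {h : V → ℤ} {v : V} (hv : h v ≠ 0) :
    ((Fintype.piFinset fun _ : V => s).filter fun b => ∑ w, h w * b w = 0).card ≤
      s.card ^ (Fintype.card V - 1) := by
  have hcard : (Fintype.piFinset fun _ : {w : V // w ≠ v} => s).card =
      s.card ^ (Fintype.card V - 1) := by
    rw [Fintype.card_piFinset, Finset.prod_const, Finset.card_univ]
    congr 1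
    simp [Fintype.card_subtype_compl]
  rw [← hcard]
  refine Finset.card_le_card_of_injOn (fun b w => b w.1) (fun b hb => ?_) ?_
  · simp only [Finset.coe_filter, Set.mem_ofPred_eq, Fintype.mem_piFinset] at hb
    simpa using fun w _ => hb.1 w
  · intro b hb b' hb' hbb
    simp only [Finset.coe_filter, Set.mem_ofPred_eq] at hb hb'
    have hne : ∀ w, w ≠ v → b w = b' w := fun w hw => congrFun hbb ⟨w, hw⟩
    have hsum : ∑ w ∈ Finset.univ.erase v, h w * b w =
        ∑ w ∈ Finset.univ.erase v, h w * b' w :=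
      Finset.sum_congr rfl fun w hw => by rw [hne w (Finset.ne_of_mem_erase hw)]
    have e := hb.2
    have e' := hb'.2
    rw [← Finset.add_sum_erase _ _ (Finset.mem_univ v)] at e e'
    have hveq : b v = b' v := mul_left_cancel₀ hv (by linarith)
    funext w
    by_cases hw : w = v
    · rw [hw, hveq]
    · exact hne w hw

/-- let `Δ = 2(2|V|+1)^{B'}` and pick the integers `b_v ∈ (Δ, 2Δ]`
independently and uniformly at random. With probability at least 1/2 (i.e., for at least
half of all tuples `b`), every `h ∈ ℤ^V` with `1 ≤ |h|₁ ≤ B'` has `∑_v h_v b_v ≠ 0`. -/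
theorem stmt_10 (V : Type*) [Fintype V] [DecidableEq V] [Nonempty V]
    (B' : ℕ) (hB' : 0 < B')
    (Δ : ℤ) (hΔ : Δ = 2 * (2 * (Fintype.card V : ℤ) + 1) ^ B') :
    (Fintype.piFinset (fun _ : V => Finset.Icc (Δ + 1) (2 * Δ))).card ≤
      2 * ((Fintype.piFinset (fun _ : V => Finset.Icc (Δ + 1) (2 * Δ))).filter
        (fun b : V → ℤ => ∀ h : V → ℤ,
          1 ≤ ∑ v, |h v| → ∑ v, |h v| ≤ (B' : ℤ) → ∑ v, h v * b v ≠ 0)).card := by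
  obtain ⟨S, hS, hmem⟩ := exists_finset_l1_ball_card_le V B'
  set P := Fintype.piFinset (fun _ : V => Finset.Icc (Δ + 1) (2 * Δ)) with hP
  set N := (2 * Fintype.card V + 1) ^ B' with hN
  have hΔN : Δ = ((2 * N : ℕ) : ℤ) := by rw [hΔ, hN]; push_cast; ring
  have hI : (Finset.Icc (Δ + 1) (2 * Δ)).card = 2 * N := by
    rw [Int.card_Icc]; omega
  have hPcard : P.card = (2 * N) ^ (Fintype.card V - 1) * (2 * N) := by
    rw [hP, Fintype.card_piFinset, Finset.prod_const, Finset.card_univ, hI, ← pow_succ, Nat.sub_add_cancel Fintype.card_pos]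
  have hbad : (P.filter fun b : V → ℤ => ¬ ∀ h : V → ℤ, 1 ≤ ∑ v, |h v| →
      ∑ v, |h v| ≤ (B' : ℤ) → ∑ v, h v * b v ≠ 0).card ≤
        N * (2 * N) ^ (Fintype.card V - 1) := by
    refine le_trans (Finset.card_le_card (t := (S.filter fun h => h ≠ 0).biUnion
      fun h => P.filter fun b => ∑ v, h v * b v = 0) fun b hb => ?_) ?_
    · rw [Finset.mem_filter] at hb
      obtain ⟨hbP, hb⟩ := hb
      push Not at hb
      obtain ⟨h, h1, h2, h3⟩ := hb
      simp only [Finset.mem_biUnion, Finset.mem_filter]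
      refine ⟨h, ⟨hmem h h2, ?_⟩, hbP, h3⟩
      rintro rfl
      simp at h1
    · refine (Finset.card_biUnion_le_card_mul _ _ ((2 * N) ^ (Fintype.card V - 1))
        fun h hh => ?_).trans
          (Nat.mul_le_mul_right _ ((Finset.card_filter_le _ _).trans hS))
      obtain ⟨v, hv⟩ := Function.ne_iff.mp (Finset.mem_filter.mp hh).2
      have key := card_filter_linear_eq_zero_le (Finset.Icc (Δ + 1) (2 * Δ)) (h := h) hv
      rw [hI] at key
      convert key
  have hsplit := Finset.card_filter_add_card_filter_not (s := P) (fun b : V → ℤ =>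
    ∀ h : V → ℤ, 1 ≤ ∑ v, |h v| → ∑ v, |h v| ≤ (B' : ℤ) → ∑ v, h v * b v ≠ 0)
  have hhalf : P.card = 2 * (N * (2 * N) ^ (Fintype.card V - 1)) := by rw [hPcard]; ring
  omega
end

section
/- Suppose every element of X ∪ Y ∪ Z appears in at least 2 triples of E (so that b_t ≥ ∑_{v ∈ X∪Y∪Z} b_v > 0), and suppose E contains a perfect matching M, i.e., a set of n pairwise disjoint triples covering all of X ∪ Y ∪ Z. Then S ⊔ T can be partitioned into n + 1 balanced sets, namely the canonical set {(i,j,k), i, j, k} for each triple (i,j,k) ∈ M together with the set {t} ∪ (E ∖ M). Consequently, there is a feasible transportation solution of the associated PFCT-U instance using at most 2n + m support edges, i.e., the optimum PFCT-U cost is at most 2n + m. -/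
open Finset

/-- Supply of a source (triple) in the PFCT-U instance associated to a 3DM instance:
`a_{(i,j,k)} = b_i + b_j + b_k`. -/
def tripleSupply {V : Type*} (b : V → ℤ) (e : V × V × V) : ℤ :=
  b e.1 + b e.2.1 + b e.2.2

/-- Demand of the dummy sink `t`: total supply minus the demand of all element sinks. -/
def dummyDemand {V : Type*} [DecidableEq V] (X Y Z : Finset V) (E : Finset (V × V × V))
    (b : V → ℤ) : ℤ :=
  (∑ e ∈ E, tripleSupply b e) - ∑ v ∈ X ∪ Y ∪ Z, b v

/-- Weight of an element of `S ⊔ T`: supplies count positively, demands negatively,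
so a set `U` is balanced iff its total weight is `0`.  Sinks are encoded as `Option V`,
with `some v` an element sink and `none` the dummy sink `t`. -/
def wtFn {V : Type*} [DecidableEq V] (X Y Z : Finset V) (E : Finset (V × V × V))
    (b : V → ℤ) : (V × V × V) ⊕ Option V → ℤ :=
  Sum.elim (tripleSupply b)
    (fun s => match s with
      | some v => -(b v)
      | none => -(dummyDemand X Y Z E b))

/-- The canonical balanced set `{(i,j,k), i, j, k}` associated to a triple `(i,j,k)`. -/
def canon {V : Type*} [DecidableEq V] (e : V × V × V) :
    Finset ((V × V × V) ⊕ Option V) :=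
  {Sum.inl e, Sum.inr (some e.1), Sum.inr (some e.2.1), Sum.inr (some e.2.2)}

/-- The ground set `S ⊔ T` of the PFCT-U instance. -/
def groundSet {V : Type*} [DecidableEq V] (X Y Z : Finset V) (E : Finset (V × V × V)) :
    Finset ((V × V × V) ⊕ Option V) :=
  E.image Sum.inl ∪ (X ∪ Y ∪ Z).image (fun v => Sum.inr (some v)) ∪ {Sum.inr none}

/-- Feasibility of a flow for the PFCT-U instance associated to a 3DM instance. -/
def feasibleFlow {V : Type*} [Fintype V] [DecidableEq V] (X Y Z : Finset V)
    (E : Finset (V × V × V)) (b : V → ℤ) (x : (V × V × V) → Option V → ℝ) : Prop :=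
  (∀ e s, 0 ≤ x e s) ∧
  (∀ e ∉ E, ∀ s, x e s = 0) ∧
  (∀ v, v ∉ X ∪ Y ∪ Z → ∀ e, x e (some v) = 0) ∧
  (∀ e ∈ E, ∑ s : Option V, x e s = (tripleSupply b e : ℝ)) ∧
  (∀ v ∈ X ∪ Y ∪ Z, ∑ e : V × V × V, x e (some v) = (b v : ℝ)) ∧
  (∑ e : V × V × V, x e none = (dummyDemand X Y Z E b : ℝ))

open Classical in
/-- Cost of a flow in the PFCT-U instance: the number of support edges. -/
noncomputable def flowCost {V : Type*} [Fintype V] (x : (V × V × V) → Option V → ℝ) : ℕ :=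
  (Finset.univ.filter (fun p : (V × V × V) × Option V => 0 < x p.1 p.2)).card

/-- A set of `n` triples in `X × Y × Z` with pairwise distinct coordinates, where
`|X| = |Y| = |Z| = n`, uses every element of `X ∪ Y ∪ Z` exactly once, so a sum over the
elements splits along its triples. -/
lemma sum_elements_eq_sum_matching {V R : Type*} [DecidableEq V] [AddCommMonoid R]
    {X Y Z : Finset V} {n : ℕ}
    (hX : X.card = n) (hY : Y.card = n) (hZ : Z.card = n)
    (hXY : Disjoint X Y) (hXZ : Disjoint X Z) (hYZ : Disjoint Y Z)
    {M : Finset (V × V × V)} (hM : ∀ e ∈ M, e.1 ∈ X ∧ e.2.1 ∈ Y ∧ e.2.2 ∈ Z)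
    (hMcard : M.card = n)
    (hMdisj : ∀ e ∈ M, ∀ e' ∈ M, e ≠ e' →
      e.1 ≠ e'.1 ∧ e.2.1 ≠ e'.2.1 ∧ e.2.2 ≠ e'.2.2) (g : V → R) :
    ∑ v ∈ X ∪ Y ∪ Z, g v = ∑ e ∈ M, (g e.1 + g e.2.1 + g e.2.2) := by
  have key : ∀ (W : Finset V) (p : V × V × V → V), W.card = n → (∀ e ∈ M, p e ∈ W) →
      (∀ e ∈ M, ∀ e' ∈ M, e ≠ e' → p e ≠ p e') → ∑ v ∈ W, g v = ∑ e ∈ M, g (p e) := by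
    intro W p hW hp hinj
    have hinj' : Set.InjOn p M := fun e he e' he' h => by
      by_contra hne
      exact hinj e he e' he' hne h
    have himg : M.image p = W := by
      apply Finset.eq_of_subset_of_card_le
      · exact Finset.image_subset_iff.2 hp
      · rw [Finset.card_image_of_injOn hinj', hW, hMcard]
    rw [← himg, Finset.sum_image hinj']
  rw [Finset.sum_union (Finset.disjoint_union_left.2 ⟨hXZ, hYZ⟩), Finset.sum_union hXY,
    key X (fun e => e.1) hX (fun e he => (hM e he).1)
      (fun e he e' he' h => (hMdisj e he e' he' h).1),
    key Y (fun e => e.2.1) hY (fun e he => (hM e he).2.1)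
      (fun e he e' he' h => (hMdisj e he e' he' h).2.1),
    key Z (fun e => e.2.2) hZ (fun e he => (hM e he).2.2)
      (fun e he e' he' h => (hMdisj e he e' he' h).2.2),
    Finset.sum_add_distrib, Finset.sum_add_distrib]

/-- A canonical set is balanced when the entries of its triple are distinct. -/
lemma sum_wtFn_canon {V : Type*} [DecidableEq V] (X Y Z : Finset V)
    (E : Finset (V × V × V)) (b : V → ℤ) {e : V × V × V}
    (h12 : e.1 ≠ e.2.1) (h13 : e.1 ≠ e.2.2) (h23 : e.2.1 ≠ e.2.2) :
    ∑ w ∈ canon e, wtFn X Y Z E b w = 0 := by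
  unfold canon
  rw [Finset.sum_insert (by simp), Finset.sum_insert (by simp [h12, h13]),
    Finset.sum_insert (by simp [h23]), Finset.sum_singleton]
  simp only [wtFn, Sum.elim_inl, Sum.elim_inr, tripleSupply]
  ring

/-- The flow in which every matching triple serves its own three elements and every other
triple of `E` sends its whole supply to the dummy sink. -/
def matchingFlow {V : Type*} [DecidableEq V] (E M : Finset (V × V × V)) (b : V → ℤ)
    (e : V × V × V) : Option V → ℝ
  | some v => if e ∈ M ∧ (v = e.1 ∨ v = e.2.1 ∨ v = e.2.2) then (b v : ℝ) else 0
  | none => if e ∈ E \ M then (tripleSupply b e : ℝ) else 0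

lemma flowCost_matchingFlow_le {V : Type*} [Fintype V] [DecidableEq V]
    {E M : Finset (V × V × V)} (hME : M ⊆ E) (b : V → ℤ) :
    flowCost (matchingFlow E M b) ≤ 2 * M.card + E.card := by
  classical
  have hsub : (Finset.univ.filter
      (fun p : (V × V × V) × Option V => 0 < matchingFlow E M b p.1 p.2)) ⊆
      ((M.image (fun e => (e, some e.1)) ∪ M.image (fun e => (e, some e.2.1))) ∪
        M.image (fun e => (e, some e.2.2))) ∪ (E \ M).image (fun e => (e, none)) := by
    rintro ⟨e, s⟩ hp
    have hpos : 0 < matchingFlow E M b e s := (Finset.mem_filter.1 hp).2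
    cases s with
    | none =>
      by_cases h : e ∈ E \ M
      · exact Finset.mem_union_right _ (Finset.mem_image_of_mem _ h)
      · simp only [matchingFlow, if_neg h, lt_irrefl] at hpos
    | some v =>
      by_cases h : e ∈ M ∧ (v = e.1 ∨ v = e.2.1 ∨ v = e.2.2)
      · obtain ⟨he, rfl | rfl | rfl⟩ := h
        · exact Finset.mem_union_left _ (Finset.mem_union_left _
            (Finset.mem_union_left _ (Finset.mem_image.2 ⟨e, he, rfl⟩)))
        · exact Finset.mem_union_left _ (Finset.mem_union_left _
            (Finset.mem_union_right _ (Finset.mem_image.2 ⟨e, he, rfl⟩)))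
        · exact Finset.mem_union_left _
            (Finset.mem_union_right _ (Finset.mem_image.2 ⟨e, he, rfl⟩))
      · simp only [matchingFlow, if_neg h, lt_irrefl] at hpos
  have hcard : flowCost (matchingFlow E M b) ≤
      M.card + M.card + M.card + (E \ M).card := by
    unfold flowCost
    refine le_trans (le_of_eq (by congr)) (le_trans (Finset.card_le_card hsub) ?_)
    refine (Finset.card_union_le _ _).trans (add_le_add ?_ Finset.card_image_le)
    refine (Finset.card_union_le _ _).trans (add_le_add ?_ Finset.card_image_le)
    exact (Finset.card_union_le _ _).trans
      (add_le_add Finset.card_image_le Finset.card_image_le)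
  have := Finset.card_sdiff_add_card_eq_card hME
  omega

/-- if every element appears in at least 2 triples and `E` contains a
perfect matching `M`, then `S ⊔ T` is partitioned into the `n + 1` balanced sets given by
the canonical set of each triple of `M` together with `{t} ∪ (E ∖ M)`; consequently the
associated PFCT-U instance has a feasible solution of cost at most `2n + m`. -/
theorem stmt_11
    (V : Type*) [Fintype V] [DecidableEq V]
    (X Y Z : Finset V) (n : ℕ)
    (hX : X.card = n) (hY : Y.card = n) (hZ : Z.card = n)
    (hXY : Disjoint X Y) (hXZ : Disjoint X Z) (hYZ : Disjoint Y Z)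
    (E : Finset (V × V × V)) (m : ℕ) (hm : E.card = m)
    (hE : ∀ e ∈ E, e.1 ∈ X ∧ e.2.1 ∈ Y ∧ e.2.2 ∈ Z)
    (b : V → ℤ) (hbpos : ∀ v ∈ X ∪ Y ∪ Z, 0 < b v)
    (hfreq : ∀ v ∈ X ∪ Y ∪ Z,
      2 ≤ (E.filter (fun e => e.1 = v ∨ e.2.1 = v ∨ e.2.2 = v)).card)
    (M : Finset (V × V × V)) (hME : M ⊆ E) (hMcard : M.card = n)
    (hMdisj : ∀ e ∈ M, ∀ e' ∈ M, e ≠ e' →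
      e.1 ≠ e'.1 ∧ e.2.1 ≠ e'.2.1 ∧ e.2.2 ≠ e'.2.2)
    (hMcover : ∀ v ∈ X ∪ Y ∪ Z, ∃ e ∈ M, v = e.1 ∨ v = e.2.1 ∨ v = e.2.2) :
    ((insert (insert (Sum.inr none) ((E \ M).image Sum.inl)) (M.image canon)).card = n + 1 ∧
      (∀ U ∈ insert (insert (Sum.inr none) ((E \ M).image Sum.inl)) (M.image canon),
        ∑ w ∈ U, wtFn X Y Z E b w = 0) ∧
      (∀ U ∈ insert (insert (Sum.inr none) ((E \ M).image Sum.inl)) (M.image canon),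
        ∀ U' ∈ insert (insert (Sum.inr none) ((E \ M).image Sum.inl)) (M.image canon),
          U ≠ U' → Disjoint U U') ∧
      (∀ w ∈ groundSet X Y Z E,
        ∃ U ∈ insert (insert (Sum.inr none) ((E \ M).image Sum.inl)) (M.image canon),
          w ∈ U) ∧
      (∀ U ∈ insert (insert (Sum.inr none) ((E \ M).image Sum.inl)) (M.image canon),
        U ⊆ groundSet X Y Z E)) ∧
    ∃ x : (V × V × V) → Option V → ℝ,
      feasibleFlow X Y Z E b x ∧ flowCost x ≤ 2 * n + m := by
  have hM : ∀ e ∈ M, e.1 ∈ X ∧ e.2.1 ∈ Y ∧ e.2.2 ∈ Z := fun e he => hE e (hME he)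
  have hXY' : ∀ v ∈ X, v ∉ Y := fun v h h' => Finset.disjoint_left.1 hXY h h'
  have hXZ' : ∀ v ∈ X, v ∉ Z := fun v h h' => Finset.disjoint_left.1 hXZ h h'
  have hYZ' : ∀ v ∈ Y, v ∉ Z := fun v h h' => Finset.disjoint_left.1 hYZ h h'
  have hne : ∀ e ∈ E, e.1 ≠ e.2.1 ∧ e.1 ≠ e.2.2 ∧ e.2.1 ≠ e.2.2 := by
    intro e he
    obtain ⟨h1, h2, h3⟩ := hE e he
    exact ⟨fun h => hXY' _ h1 (h ▸ h2), fun h => hXZ' _ h1 (h ▸ h3),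
      fun h => hYZ' _ h2 (h ▸ h3)⟩
  have huniq : ∀ v, ∀ e ∈ M, ∀ e' ∈ M, (v = e.1 ∨ v = e.2.1 ∨ v = e.2.2) →
      (v = e'.1 ∨ v = e'.2.1 ∨ v = e'.2.2) → e = e' := by
    intro v e he e' he' h h'
    by_contra hee
    obtain ⟨d1, d2, d3⟩ := hMdisj e he e' he' hee
    obtain ⟨h1, h2, h3⟩ := hM e he
    obtain ⟨h1', h2', h3'⟩ := hM e' he'
    grind
  have hmemA : ∀ e ∈ E, e.1 ∈ X ∪ Y ∪ Z ∧ e.2.1 ∈ X ∪ Y ∪ Z ∧ e.2.2 ∈ X ∪ Y ∪ Z := by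
    intro e he
    obtain ⟨h1, h2, h3⟩ := hE e he
    simp [h1, h2, h3]
  have hdummy : dummyDemand X Y Z E b = ∑ e ∈ E \ M, tripleSupply b e := by
    unfold dummyDemand
    rw [sum_elements_eq_sum_matching hX hY hZ hXY hXZ hYZ hM hMcard hMdisj,
      ← Finset.sum_sdiff hME]
    exact add_sub_cancel_right _ _
  have hcanon : ∀ (e : V × V × V) (w), w ∈ canon e ↔ w = Sum.inl e ∨
      ∃ v, w = Sum.inr (some v) ∧ (v = e.1 ∨ v = e.2.1 ∨ v = e.2.2) := by
    intro e w
    simp only [canon, Finset.mem_insert, Finset.mem_singleton]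
    grind
  have hrest : ∀ w : (V × V × V) ⊕ Option V,
      w ∈ insert (Sum.inr none) ((E \ M).image Sum.inl) ↔
        w = Sum.inr none ∨ ∃ e ∈ E, e ∉ M ∧ w = Sum.inl e := by
    intro w
    simp only [Finset.mem_insert, Finset.mem_image, Finset.mem_sdiff]
    grind
  have hcc : ∀ e ∈ M, ∀ e' ∈ M, e ≠ e' → Disjoint (canon e) (canon e') := by
    intro e he e' he' hee
    rw [Finset.disjoint_left]
    intro w hw hw'
    rw [hcanon] at hw hw'
    grind
  have hcr : ∀ e ∈ M,
      Disjoint (canon e) (insert (Sum.inr none) ((E \ M).image Sum.inl)) := by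
    intro e he
    rw [Finset.disjoint_left]
    intro w hw hw'
    rw [hcanon] at hw
    rw [hrest] at hw'
    grind
  refine ⟨⟨?_, ?_, ?_, ?_, ?_⟩, matchingFlow E M b, ⟨?_, ?_, ?_, ?_, ?_, ?_⟩, ?_⟩
  · rw [Finset.card_insert_of_notMem, Finset.card_image_of_injOn, hMcard]
    · intro e he e' he' h
      by_contra hee
      have hd := hcc e he e' he' hee
      have hin : Sum.inl e ∈ canon e := (hcanon _ _).2 (Or.inl rfl)
      exact Finset.disjoint_left.1 hd hin (h ▸ hin)
    · intro h
      obtain ⟨e, he, h⟩ := Finset.mem_image.1 h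
      have hin : Sum.inl e ∈ canon e := (hcanon _ _).2 (Or.inl rfl)
      exact Finset.disjoint_left.1 (hcr e he) hin (h ▸ hin)
  · intro U hU
    rcases Finset.mem_insert.1 hU with rfl | hU
    · rw [Finset.sum_insert (by simp), Finset.sum_image (by simp)]
      simp only [wtFn, Sum.elim_inl, Sum.elim_inr, hdummy]
      ring
    · obtain ⟨e, he, rfl⟩ := Finset.mem_image.1 hU
      obtain ⟨h12, h13, h23⟩ := hne e (hME he)
      exact sum_wtFn_canon X Y Z E b h12 h13 h23
  · intro U hU U' hU' hUU
    rcases Finset.mem_insert.1 hU with rfl | hU <;>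
      rcases Finset.mem_insert.1 hU' with rfl | hU'
    · exact absurd rfl hUU
    · obtain ⟨e, he, rfl⟩ := Finset.mem_image.1 hU'
      exact (hcr e he).symm
    · obtain ⟨e, he, rfl⟩ := Finset.mem_image.1 hU
      exact hcr e he
    · obtain ⟨e, he, rfl⟩ := Finset.mem_image.1 hU
      obtain ⟨e', he', rfl⟩ := Finset.mem_image.1 hU'
      exact hcc e he e' he' (fun h => hUU (h ▸ rfl))
  · have hcan : ∀ e ∈ M, canon e ∈
        insert (insert (Sum.inr none) ((E \ M).image Sum.inl)) (M.image canon) :=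
      fun e he => Finset.mem_insert_of_mem (Finset.mem_image_of_mem _ he)
    rintro (e | _ | v) hw
    · have he : e ∈ E := by simpa [groundSet] using hw
      by_cases heM : e ∈ M
      · exact ⟨canon e, hcan e heM, (hcanon _ _).2 (Or.inl rfl)⟩
      · exact ⟨_, Finset.mem_insert_self _ _, (hrest _).2 (Or.inr ⟨e, he, heM, rfl⟩)⟩
    · exact ⟨_, Finset.mem_insert_self _ _, (hrest _).2 (Or.inl rfl)⟩
    · have hv : v ∈ X ∪ Y ∪ Z := by simpa [groundSet] using hw
      obtain ⟨e, he, h⟩ := hMcover v hv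
      exact ⟨canon e, hcan e he, (hcanon _ _).2 (Or.inr ⟨v, rfl, h⟩)⟩
  · intro U hU w hw
    rcases Finset.mem_insert.1 hU with rfl | hU
    · rcases (hrest w).1 hw with rfl | ⟨e, he, -, rfl⟩
      · simp [groundSet]
      · simp [groundSet, he]
    · obtain ⟨e, he, rfl⟩ := Finset.mem_image.1 hU
      obtain ⟨h1, h2, h3⟩ := hM e he
      rcases (hcanon e w).1 hw with rfl | ⟨v, rfl, rfl | rfl | rfl⟩
      · simp [groundSet, hME he]
      · simp [groundSet, h1]
      · simp [groundSet, h2]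
      · simp [groundSet, h3]
  · rintro e (_ | v)
    · simp only [matchingFlow]
      split_ifs with h
      · obtain ⟨h1, h2, h3⟩ := hmemA e (Finset.mem_sdiff.1 h).1
        have := hbpos _ h1
        have := hbpos _ h2
        have := hbpos _ h3
        have : 0 ≤ tripleSupply b e := by unfold tripleSupply; omega
        exact_mod_cast this
      · exact le_rfl
    · simp only [matchingFlow]
      split_ifs with h
      · obtain ⟨he, h⟩ := h
        obtain ⟨h1, h2, h3⟩ := hmemA e (hME he)
        have hv : v ∈ X ∪ Y ∪ Z := by rcases h with rfl | rfl | rfl <;> assumption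
        exact_mod_cast (hbpos v hv).le
      · exact le_rfl
  · rintro e he (_ | v)
    · exact if_neg fun h => he (Finset.mem_sdiff.1 h).1
    · exact if_neg fun h => he (hME h.1)
  · intro v hv e
    refine if_neg fun h => hv ?_
    obtain ⟨h1, h2, h3⟩ := hmemA e (hME h.1)
    rcases h.2 with rfl | rfl | rfl <;> assumption
  · intro e he
    rw [Fintype.sum_option]
    by_cases heM : e ∈ M
    · obtain ⟨h12, h13, h23⟩ := hne e he
      have hfil : Finset.univ.filter (fun v => v = e.1 ∨ v = e.2.1 ∨ v = e.2.2) =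
          {e.1, e.2.1, e.2.2} := by
        ext v
        simp
      simp only [matchingFlow, Finset.mem_sdiff, heM, not_true_eq_false, and_false,
        if_false, true_and, zero_add]
      rw [← Finset.sum_filter, hfil, Finset.sum_insert (by simp [h12, h13]),
        Finset.sum_insert (by simp [h23]), Finset.sum_singleton]
      simp only [tripleSupply]
      push_cast
      ring
    · simp [matchingFlow, heM, he]
  · intro v hv
    obtain ⟨e, he, h⟩ := hMcover v hv
    rw [Finset.sum_eq_single e]
    · exact if_pos ⟨he, h⟩
    · intro e' _ hne'
      exact if_neg fun h' => hne' (huniq v e' h'.1 e he h'.2 h)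
    · simp
  · simp only [matchingFlow]
    rw [hdummy, ← Finset.sum_filter, Finset.filter_univ_mem, Int.cast_sum]
  · simpa only [hMcard, hm] using flowCost_matchingFlow_le hME b
end

section
/- Let B' be a positive integer, Δ a positive integer, and suppose: (i) each element of X ∪ Y ∪ Z appears in at least 2 triples of E; (ii) b_v is an integer with Δ < b_v ≤ 2Δ for every v ∈ X ∪ Y ∪ Z; (iii) for every h ∈ ℤ^{X∪Y∪Z} with 1 ≤ ∑_v |h_v| ≤ B', we have ∑_v h_v b_v ≠ 0; and (iv) n/2 + 1 ≥ B'/3. Then every nonempty balanced set U ⊆ S ∪ T of the associated PFCT-U instance is either a disjoint union of canonical sets or has |U| ≥ B'/3. -/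
open Finset

/-- Number of coordinates of the triple `e` that are equal to `v`. -/
def incidence {V : Type*} [DecidableEq V] (e : V × V × V) (v : V) : ℤ :=
  (if e.1 = v then 1 else 0) + (if e.2.1 = v then 1 else 0) + (if e.2.2 = v then 1 else 0)

section Incidence

variable {V : Type*} [DecidableEq V]

lemma incidence_nonneg (e : V × V × V) (v : V) : 0 ≤ incidence e v := by
  unfold incidence
  split_ifs <;> norm_num

lemma one_le_incidence_iff (e : V × V × V) (v : V) :
    1 ≤ incidence e v ↔ e.1 = v ∨ e.2.1 = v ∨ e.2.2 = v := by
  unfold incidence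
  split_ifs <;> simp_all

lemma inr_some_mem_canon (e : V × V × V) (v : V) :
    Sum.inr (some v) ∈ canon e ↔ 1 ≤ incidence e v := by
  rw [one_le_incidence_iff]
  simp [canon, eq_comm]

lemma sum_incidence_mul [Fintype V] (b : V → ℤ) (e : V × V × V) :
    ∑ v, incidence e v * b v = tripleSupply b e := by
  simp [incidence, tripleSupply, add_mul, sum_add_distrib]

lemma sum_incidence [Fintype V] (e : V × V × V) : ∑ v, incidence e v = 3 := by
  simp [incidence, sum_add_distrib]

lemma sum_tripleSupply [Fintype V] (b : V → ℤ) (P : Finset (V × V × V)) :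
    ∑ e ∈ P, tripleSupply b e = ∑ v, (∑ e ∈ P, incidence e v) * b v := by
  simp_rw [sum_mul, ← sum_incidence_mul b]
  exact sum_comm

lemma card_filter_le_sum_incidence (E : Finset (V × V × V)) (v : V) :
    ((E.filter (fun e => e.1 = v ∨ e.2.1 = v ∨ e.2.2 = v)).card : ℤ) ≤
      ∑ e ∈ E, incidence e v := by
  rw [card_filter]
  push_cast
  refine sum_le_sum fun e _ => ?_
  split_ifs with h
  · exact (one_le_incidence_iff e v).2 h
  · exact incidence_nonneg e v

/-- If no element has more than one incidence with `P`, then the canonical sets of the triples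
of `P` are pairwise disjoint. -/
lemma disjoint_canon {P : Finset (V × V × V)} (hP : ∀ v, ∑ e ∈ P, incidence e v ≤ 1)
    {e e' : V × V × V} (he : e ∈ P) (he' : e' ∈ P) (hne : e ≠ e') :
    Disjoint (canon e) (canon e') := by
  rw [disjoint_left]
  rintro (f | _ | v) h h'
  · simp only [canon, mem_insert, Sum.inl.injEq, mem_singleton, reduceCtorEq, or_false] at h h'
    exact hne (h.symm.trans h')
  · simp [canon] at h
  · rw [inr_some_mem_canon] at h h'
    have hsub : ({e, e'} : Finset (V × V × V)) ⊆ P := by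
      simp [insert_subset_iff, he, he']
    have hle := sum_le_sum_of_subset_of_nonneg hsub
      (fun f _ _ => incidence_nonneg f v)
    rw [sum_pair hne] at hle
    linarith [hP v]

/-- The dummy demand is at least the total demand of the other sinks when every element lies in
at least two triples. -/
lemma sum_le_dummyDemand [Fintype V] {X Y Z : Finset V} {E : Finset (V × V × V)} {b : V → ℤ}
    (hE : ∀ e ∈ E, e.1 ∈ X ∧ e.2.1 ∈ Y ∧ e.2.2 ∈ Z)
    (hfreq : ∀ v ∈ X ∪ Y ∪ Z,
      2 ≤ (E.filter (fun e => e.1 = v ∨ e.2.1 = v ∨ e.2.2 = v)).card)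
    (hb : ∀ v ∈ X ∪ Y ∪ Z, 0 ≤ b v) :
    ∑ v ∈ X ∪ Y ∪ Z, b v ≤ dummyDemand X Y Z E b := by
  have hsupply : ∑ v ∈ X ∪ Y ∪ Z, 2 * b v ≤ ∑ e ∈ E, tripleSupply b e := by
    rw [sum_tripleSupply]
    have hvanish : ∀ v ∈ univ, v ∉ X ∪ Y ∪ Z → (∑ e ∈ E, incidence e v) * b v = 0 := by
      intro v _ hv
      rw [sum_eq_zero, zero_mul]
      intro e he
      refine le_antisymm ?_ (incidence_nonneg e v)
      by_contra! h
      obtain ⟨h1, h2, h3⟩ := hE e he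
      rcases (one_le_incidence_iff e v).1 h with rfl | rfl | rfl <;> simp_all
    rw [← sum_subset (subset_univ (X ∪ Y ∪ Z)) hvanish]
    refine sum_le_sum fun v hv => mul_le_mul_of_nonneg_right ?_ (hb v hv)
    exact le_trans (by exact_mod_cast hfreq v hv) (card_filter_le_sum_incidence E v)
  rw [← mul_sum] at hsupply
  unfold dummyDemand
  linarith

end Incidence

/-- Splitting the weight of a set into the contributions of its triples and of its sinks. -/
lemma sum_wtFn {V : Type*} [DecidableEq V] (X Y Z : Finset V) (E : Finset (V × V × V))
    (b : V → ℤ) (U : Finset ((V × V × V) ⊕ Option V)) :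
    ∑ w ∈ U, wtFn X Y Z E b w = ∑ e ∈ U.toLeft, tripleSupply b e
      - (∑ v ∈ U.toRight.eraseNone, b v)
      - (if Sum.inr none ∈ U then dummyDemand X Y Z E b else 0) := by
  rw [sum_sum_eq_sum_toLeft_add_sum_toRight]
  have hright : ∑ s ∈ U.toRight, wtFn X Y Z E b (Sum.inr s) =
      -(∑ v ∈ U.toRight.eraseNone, b v)
        - (if Sum.inr none ∈ U then dummyDemand X Y Z E b else 0) := by
    by_cases h : Sum.inr none ∈ U
    · rw [← insert_erase (mem_toRight.2 h), sum_insert (notMem_erase _ _),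
        ← map_some_eraseNone, sum_map]
      simp [wtFn, h]
      ring
    · have hnone : none ∉ U.toRight := by simpa using h
      rw [← erase_eq_of_notMem hnone, ← map_some_eraseNone, sum_map]
      simp [wtFn, h]
  rw [hright]
  simp only [wtFn, Sum.elim_inl]
  ring

/-- under the stated conditions on `Δ`, `B'` and the random demands `b`,
every nonempty balanced subset `U` of `S ⊔ T` is either a disjoint union of canonical
sets or satisfies `|U| ≥ B'/3`. -/
theorem stmt_12
    (V : Type*) [Fintype V] [DecidableEq V]
    (X Y Z : Finset V) (n : ℕ)
    (hX : X.card = n) (hY : Y.card = n) (hZ : Z.card = n)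
    (hXY : Disjoint X Y) (hXZ : Disjoint X Z) (hYZ : Disjoint Y Z)
    (E : Finset (V × V × V)) (m : ℕ) (hm : E.card = m)
    (hE : ∀ e ∈ E, e.1 ∈ X ∧ e.2.1 ∈ Y ∧ e.2.2 ∈ Z)
    (B' : ℕ) (hB' : 0 < B') (Δ : ℤ) (hΔpos : 0 < Δ)
    (b : V → ℤ)
    (hfreq : ∀ v ∈ X ∪ Y ∪ Z,
      2 ≤ (E.filter (fun e => e.1 = v ∨ e.2.1 = v ∨ e.2.2 = v)).card)
    (hbrange : ∀ v ∈ X ∪ Y ∪ Z, Δ < b v ∧ b v ≤ 2 * Δ)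
    (hindep : ∀ h : V → ℤ, (∀ v, v ∉ X ∪ Y ∪ Z → h v = 0) →
      1 ≤ ∑ v, |h v| → ∑ v, |h v| ≤ (B' : ℤ) → ∑ v, h v * b v ≠ 0)
    (hnB : (B' : ℝ) / 3 ≤ (n : ℝ) / 2 + 1)
    (U : Finset ((V × V × V) ⊕ Option V))
    (hUsub : U ⊆ groundSet X Y Z E)
    (hUne : U.Nonempty)
    (hUbal : ∑ w ∈ U, wtFn X Y Z E b w = 0) :
    (∃ M : Finset (V × V × V), M ⊆ E ∧
      (∀ e ∈ M, ∀ e' ∈ M, e ≠ e' → Disjoint (canon e) (canon e')) ∧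
      U = M.biUnion canon) ∨
    (B' : ℝ) / 3 ≤ (U.card : ℝ) := by
  have hbpos : ∀ v ∈ X ∪ Y ∪ Z, 0 ≤ b v := fun v hv => by linarith [(hbrange v hv).1]
  have hPE : U.toLeft ⊆ E := fun e he => by
    simpa [groundSet] using hUsub (mem_toLeft.1 he)
  have hQ : U.toRight.eraseNone ⊆ X ∪ Y ∪ Z := fun v hv => by
    simpa [groundSet] using hUsub (mem_toRight.1 (mem_eraseNone.1 hv))
  have hcard : U.toLeft.card + U.toRight.card = U.card := card_toLeft_add_card_toRight
  have hmem : ∀ e ∈ E, e.1 ∈ X ∪ Y ∪ Z ∧ e.2.1 ∈ X ∪ Y ∪ Z ∧ e.2.2 ∈ X ∪ Y ∪ Z := by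
    intro e he
    obtain ⟨h1, h2, h3⟩ := hE e he
    simp [h1, h2, h3]
  rw [sum_wtFn] at hUbal
  by_cases hnone : Sum.inr none ∈ U
  · right
    rw [if_pos hnone] at hUbal
    have hdemand := sum_le_dummyDemand hE hfreq hbpos
    have hground : (X ∪ Y ∪ Z).card = 3 * n := by
      rw [card_union_of_disjoint (disjoint_union_left.2 ⟨hXZ, hYZ⟩),
        card_union_of_disjoint hXY]
      omega
    have hlow : 3 * n * Δ ≤ ∑ v ∈ X ∪ Y ∪ Z, b v := by
      have := card_nsmul_le_sum (X ∪ Y ∪ Z) b Δ fun v hv => (hbrange v hv).1.le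
      rw [hground] at this
      simpa using this
    have hhigh : ∑ e ∈ U.toLeft, tripleSupply b e ≤ U.toLeft.card * (6 * Δ) := by
      have := sum_le_card_nsmul U.toLeft (tripleSupply b) (6 * Δ) fun e he => by
        obtain ⟨h1, h2, h3⟩ := hmem e (hPE he)
        unfold tripleSupply
        linarith [(hbrange _ h1).2, (hbrange _ h2).2, (hbrange _ h3).2]
      simpa using this
    have hQnonneg : 0 ≤ ∑ v ∈ U.toRight.eraseNone, b v :=
      sum_nonneg fun v hv => hbpos v (hQ hv)
    have hn : (n : ℤ) ≤ 2 * U.toLeft.card := by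
      refine le_of_mul_le_mul_right ?_ (by linarith : 0 < 3 * Δ)
      linarith
    have hpos : 0 < U.toRight.card := card_pos.2 ⟨none, mem_toRight.2 hnone⟩
    have : n + 2 ≤ 2 * U.card := by omega
    have : (n : ℝ) + 2 ≤ 2 * U.card := by exact_mod_cast this
    linarith
  · rw [if_neg hnone, sub_zero] at hUbal
    by_contra! hcon
    obtain ⟨hnot, hsmall⟩ := hcon
    have hsmall : 3 * U.card < B' := by
      have : (3 : ℝ) * U.card < B' := by linarith
      exact_mod_cast this
    set P := U.toLeft with hPdef
    set Q := U.toRight.eraseNone with hQdef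
    have hQcard : Q.card ≤ U.toRight.card := by
      rw [hQdef, ← card_map Function.Embedding.some, map_some_eraseNone]
      exact card_erase_le
    let h : V → ℤ := fun v => (∑ e ∈ P, incidence e v) - if v ∈ Q then 1 else 0
    have hsupp : ∀ v, v ∉ X ∪ Y ∪ Z → h v = 0 := by
      intro v hv
      have hvQ : v ∉ Q := fun hvQ => hv (hQ hvQ)
      simp only [h, if_neg hvQ, sub_zero]
      refine sum_eq_zero fun e he => le_antisymm ?_ (incidence_nonneg e v)
      by_contra! hlt
      obtain ⟨h1, h2, h3⟩ := hmem e (hPE he)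
      rcases (one_le_incidence_iff e v).1 hlt with rfl | rfl | rfl <;> contradiction
    have hzero : ∑ v, h v * b v = 0 := by
      rw [sum_tripleSupply] at hUbal
      simpa [h, sub_mul, sum_sub_distrib] using hUbal
    have hnorm : ∑ v, |h v| ≤ 3 * P.card + Q.card := by
      calc ∑ v, |h v| ≤ ∑ v, ((∑ e ∈ P, incidence e v) + if v ∈ Q then 1 else 0) := by
            refine sum_le_sum fun v _ => (abs_sub _ _).trans_eq ?_
            rw [abs_of_nonneg (sum_nonneg fun e _ => incidence_nonneg e v),
              abs_of_nonneg (by split_ifs <;> norm_num)]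
        _ = 3 * P.card + Q.card := by
            rw [sum_add_distrib, sum_comm]
            simp [sum_incidence, mul_comm]
    have hh : ∀ v, h v = 0 := by
      by_contra! hex
      obtain ⟨v, hv⟩ := hex
      refine hindep h hsupp ?_ (by omega) hzero
      exact (Int.one_le_abs hv).trans
        (single_le_sum (f := fun v => |h v|) (fun _ _ => abs_nonneg _) (mem_univ v))
    have hinc : ∀ v, ∑ e ∈ P, incidence e v = if v ∈ Q then 1 else 0 :=
      fun v => sub_eq_zero.1 (hh v)
    refine hnot P hPE (fun e he e' he' hne => disjoint_canon (fun v => ?_) he he' hne) ?_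
    · rw [hinc]
      split_ifs <;> norm_num
    · ext w
      rw [mem_biUnion]
      rcases w with e | _ | v
      · simp [canon, hPdef]
      · simp [canon, hnone]
      · simp_rw [inr_some_mem_canon]
        have hvQ : Sum.inr (some v) ∈ U ↔ v ∈ Q := by simp [hQdef]
        rw [hvQ]
        constructor
        · intro hv
          by_contra! hno
          have := sum_nonpos fun e he => Int.lt_add_one_iff.1 (hno e he)
          rw [hinc, if_pos hv] at this
          norm_num at this
        · rintro ⟨e, he, hev⟩
          by_contra hv
          have := single_le_sum (fun f _ => incidence_nonneg f v) he
          rw [hinc, if_neg hv] at this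
          linarith
end

section
/- Let s ≥ 4 be a real number and μ a nonnegative integer such that every matching M ⊆ E satisfies |M| ≤ μ. Let 𝒫 be a partition of S ⊔ T (a set of cardinality 3n + m + 1) into nonempty balanced sets, each of which is either canonical or has size at least s. Then |𝒫| ≤ μ + (3n + m + 1 − 4μ)/s. -/
open Finset

lemma inl_mem_canon {V : Type*} [DecidableEq V] {e e' : V × V × V} :
    Sum.inl e ∈ canon e' ↔ e = e' := by
  simp [canon]

lemma canon_injective {V : Type*} [DecidableEq V] :
    Function.Injective (canon : V × V × V → _) := fun _ _ h =>
  inl_mem_canon.1 (h ▸ inl_mem_canon.2 rfl)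

lemma card_canon {V : Type*} [DecidableEq V] {e : V × V × V}
    (h₁ : e.1 ≠ e.2.1) (h₂ : e.1 ≠ e.2.2) (h₃ : e.2.1 ≠ e.2.2) : (canon e).card = 4 := by
  simp [canon, Finset.card_insert_of_notMem, h₁, h₂, h₃]

lemma ne_of_disjoint_canon {V : Type*} [DecidableEq V] {e e' : V × V × V}
    (h : Disjoint (canon e) (canon e')) :
    e.1 ≠ e'.1 ∧ e.2.1 ≠ e'.2.1 ∧ e.2.2 ≠ e'.2.2 := by
  rw [Finset.disjoint_left] at h
  refine ⟨fun h' => h (a := Sum.inr (some e.1)) ?_ ?_,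
    fun h' => h (a := Sum.inr (some e.2.1)) ?_ ?_,
    fun h' => h (a := Sum.inr (some e.2.2)) ?_ ?_⟩ <;> simp [canon, h']

lemma card_groundSet_le {V : Type*} [DecidableEq V] (X Y Z : Finset V)
    (E : Finset (V × V × V)) :
    (groundSet X Y Z E).card ≤ E.card + (X.card + Y.card + Z.card) + 1 := by
  refine (Finset.card_union_le _ _).trans (Nat.add_le_add ?_ (by simp))
  refine (Finset.card_union_le _ _).trans (Nat.add_le_add Finset.card_image_le ?_)
  exact Finset.card_image_le.trans ((Finset.card_union_le _ _).trans
    (Nat.add_le_add_right (Finset.card_union_le _ _) _))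

/-- if every matching in `E` has size at most `μ`, `s ≥ 4`, and `𝒫` is a
partition of `S ⊔ T` into nonempty balanced sets each of which is canonical or of size
at least `s`, then `|𝒫| ≤ μ + (3n + m + 1 − 4μ) / s`. -/
theorem stmt_13
    (V : Type*) [Fintype V] [DecidableEq V]
    (X Y Z : Finset V) (n : ℕ)
    (hX : X.card = n) (hY : Y.card = n) (hZ : Z.card = n)
    (hXY : Disjoint X Y) (hXZ : Disjoint X Z) (hYZ : Disjoint Y Z)
    (E : Finset (V × V × V)) (m : ℕ) (hm : E.card = m)
    (hE : ∀ e ∈ E, e.1 ∈ X ∧ e.2.1 ∈ Y ∧ e.2.2 ∈ Z)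
    (b : V → ℤ) (hbpos : ∀ v ∈ X ∪ Y ∪ Z, 0 < b v)
    (s : ℝ) (hs : 4 ≤ s) (μ : ℕ)
    (hμ : ∀ M ⊆ E, (∀ e ∈ M, ∀ e' ∈ M, e ≠ e' →
      e.1 ≠ e'.1 ∧ e.2.1 ≠ e'.2.1 ∧ e.2.2 ≠ e'.2.2) → M.card ≤ μ)
    (P : Finset (Finset ((V × V × V) ⊕ Option V)))
    (hP1 : ∀ U ∈ P, U.Nonempty)
    (hP2 : ∀ U ∈ P, ∑ w ∈ U, wtFn X Y Z E b w = 0)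
    (hP3 : ∀ U ∈ P, ∀ U' ∈ P, U ≠ U' → Disjoint U U')
    (hP4 : ∀ w ∈ groundSet X Y Z E, ∃ U ∈ P, w ∈ U)
    (hP5 : ∀ U ∈ P, U ⊆ groundSet X Y Z E)
    (hP6 : ∀ U ∈ P, (∃ e ∈ E, U = canon e) ∨ s ≤ (U.card : ℝ)) :
    (P.card : ℝ) ≤ (μ : ℝ) + (3 * n + m + 1 - 4 * μ) / s := by
  set M := E.filter (fun e => canon e ∈ P)
  have hMmem : ∀ e ∈ M, e ∈ E ∧ canon e ∈ P := fun e he => Finset.mem_filter.1 he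
  have hMμ : M.card ≤ μ := hμ M (Finset.filter_subset _ _) fun e he e' he' hne =>
    ne_of_disjoint_canon (hP3 _ (hMmem e he).2 _ (hMmem e' he').2 (canon_injective.ne hne))
  set C := M.image canon
  have hCP : C ⊆ P := Finset.image_subset_iff.2 fun e he => (hMmem e he).2
  have hCcard : C.card = M.card := Finset.card_image_of_injective _ canon_injective
  have hsum : ∑ U ∈ P, U.card ≤ m + (n + n + n) + 1 := by
    rw [← Finset.card_biUnion fun U hU U' hU' h => hP3 U hU U' hU' h]
    refine (Finset.card_le_card (Finset.biUnion_subset.2 hP5)).trans ?_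
    simpa only [hm, hX, hY, hZ] using card_groundSet_le X Y Z E
  have hcanon : ∑ U ∈ C, (U.card : ℝ) = 4 * M.card := by
    rw [Finset.sum_image fun _ _ _ _ h => canon_injective h, Finset.sum_congr rfl
      (g := fun _ => (4 : ℝ)), Finset.sum_const, nsmul_eq_mul, mul_comm]
    intro e he
    obtain ⟨h1, h2, h3⟩ := hE e (hMmem e he).1
    rw [card_canon (Finset.disjoint_iff_ne.1 hXY _ h1 _ h2)
      (Finset.disjoint_iff_ne.1 hXZ _ h1 _ h3) (Finset.disjoint_iff_ne.1 hYZ _ h2 _ h3)]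
    norm_num
  have hlarge : ((P \ C).card : ℝ) * s ≤ ∑ U ∈ P \ C, (U.card : ℝ) := by
    rw [← nsmul_eq_mul]
    refine Finset.card_nsmul_le_sum _ _ _ fun U hU => ?_
    obtain ⟨hUP, hUC⟩ := Finset.mem_sdiff.1 hU
    refine (hP6 U hUP).resolve_left ?_
    rintro ⟨e, he, rfl⟩
    exact hUC (Finset.mem_image_of_mem _ (Finset.mem_filter.2 ⟨he, hUP⟩))
  have hsplit := Finset.sum_sdiff (f := fun U => (U.card : ℝ)) hCP
  have hcard : ((P \ C).card : ℝ) + M.card = P.card := by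
    rw [← hCcard]
    exact_mod_cast Finset.card_sdiff_add_card_eq_card hCP
  have hsum' : ∑ U ∈ P, (U.card : ℝ) ≤ m + (n + n + n) + 1 := by exact_mod_cast hsum
  have hMμ' : (M.card : ℝ) ≤ μ := by exact_mod_cast hMμ
  have hs0 : 0 < s := by linarith
  rw [← sub_le_iff_le_add', le_div_iff₀ hs0, ← hcard]
  nlinarith [mul_le_mul_of_nonneg_right hMμ' (sub_nonneg.2 hs)]
end

section
/- Let (V, E) be a finite directed graph with E ⊆ V × V, edge costs c : E → ℝ_{≥0}, a root r ∈ V, and a set T ⊆ V ∖ {r} of k terminals, and assume every t ∈ T is reachable from r by a directed path in E. Consider feasible flows x : E → ℝ_{≥0} satisfying: the net outflow of r is k, the net inflow of each t ∈ T is 1, and every other vertex conserves flow. Then the minimum over such feasible flows x of the fixed cost ∑_{e ∈ E : x_e > 0} c_e equals the minimum over subgraphs H ⊆ E that contain a directed path from r to t for every t ∈ T of the total cost ∑_{e ∈ H} c_e (the optimum of the Directed Steiner Tree instance). -/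
open Finset
open Classical

/-- Net outflow of `x` at the vertex `v`. -/
def netOutflow {V : Type*} [Fintype V] (x : V × V → ℝ) (v : V) : ℝ :=
  ∑ u, x (v, u) - ∑ u, x (u, v)

lemma netOutflow_add {V : Type*} [Fintype V] (x y : V × V → ℝ) (v : V) :
    netOutflow (x + y) v = netOutflow x v + netOutflow y v := by
  simp only [netOutflow, Pi.add_apply, Finset.sum_add_distrib]
  ring

lemma netOutflow_sum {V ι : Type*} [Fintype V] (s : Finset ι) (x : ι → V × V → ℝ) (v : V) :
    netOutflow (fun e => ∑ i ∈ s, x i e) v = ∑ i ∈ s, netOutflow (x i) v := by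
  simp only [netOutflow, Finset.sum_sub_distrib]
  rw [Finset.sum_comm, Finset.sum_comm (s := Finset.univ) (t := s) (f := fun u i => x i (u, v))]

lemma netOutflow_single {V : Type*} [Fintype V] [DecidableEq V] (a b v : V) :
    netOutflow (fun e => if e = (a, b) then 1 else 0) v =
      (if v = a then 1 else 0) - (if v = b then 1 else 0) := by
  simp only [netOutflow, Prod.mk.injEq, ite_and]
  congr 1
  · split_ifs <;> simp
  · simp

/-- A directed path carries a unit flow between its end points. -/
lemma exists_unit_flow_of_reflTransGen {V : Type*} [Fintype V] [DecidableEq V]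
    {H : Finset (V × V)} {a b : V}
    (h : Relation.ReflTransGen (fun u v => (u, v) ∈ H) a b) :
    ∃ x : V × V → ℝ, (∀ e, 0 ≤ x e) ∧ (∀ e ∉ H, x e = 0) ∧
      ∀ v, netOutflow x v = (if v = a then 1 else 0) - (if v = b then 1 else 0) := by
  induction h with
  | refl => exact ⟨0, by simp, by simp, by simp [netOutflow]⟩
  | @tail b d _ hbd ih =>
    obtain ⟨x, hx0, hxH, hx⟩ := ih
    refine ⟨x + fun e => if e = (b, d) then 1 else 0, fun e => ?_, fun e he => ?_, fun v => ?_⟩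
    · have := hx0 e
      simp only [Pi.add_apply]
      positivity
    · have : e ≠ (b, d) := by
        rintro rfl
        exact he hbd
      simp [hxH e he, this]
    · rw [netOutflow_add, hx, netOutflow_single]
      ring

/-- If every terminal is reachable from `r` in `H`, then `H` supports a flow that sends one unit
from `r` to each terminal. -/
lemma exists_flow_of_reachable {V : Type*} [Fintype V] [DecidableEq V] {H : Finset (V × V)} {r : V}
    {T : Finset V} (h : ∀ t ∈ T, Relation.ReflTransGen (fun u v => (u, v) ∈ H) r t) :
    ∃ x : V × V → ℝ, (∀ e, 0 ≤ x e) ∧ (∀ e ∉ H, x e = 0) ∧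
      ∀ v, netOutflow x v = (if v = r then (T.card : ℝ) else 0) - (if v ∈ T then 1 else 0) := by
  have h' : ∀ t : T, _ := fun t => exists_unit_flow_of_reflTransGen (h t t.2)
  choose x hx0 hxH hx using h'
  refine ⟨fun e => ∑ t : T, x t e, fun e => Finset.sum_nonneg fun t _ => hx0 t e,
    fun e he => Finset.sum_eq_zero fun t _ => hxH t e he, fun v => ?_⟩
  rw [netOutflow_sum]
  simp only [hx, Finset.sum_sub_distrib]
  congr 1
  · split_ifs <;> simp
  · rw [Finset.sum_coe_sort T (fun t => if v = t then (1 : ℝ) else 0)]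
    simp

/-- A vertex set that no flow leaves has nonpositive total net outflow. -/
lemma sum_netOutflow_nonpos {V : Type*} [Fintype V] {x : V × V → ℝ} (hx0 : ∀ e, 0 ≤ x e)
    (S : Finset V) (hS : ∀ u ∈ S, ∀ v ∉ S, x (u, v) = 0) :
    ∑ v ∈ S, netOutflow x v ≤ 0 := by
  have hout : ∀ v ∈ S, ∑ u, x (v, u) = ∑ u ∈ S, x (v, u) := fun v hv =>
    (Finset.sum_subset (Finset.subset_univ S) fun u _ hu => hS v hv u hu).symm
  have hin : ∀ v ∈ S, ∑ u ∈ S, x (u, v) ≤ ∑ u, x (u, v) := fun v _ =>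
    Finset.sum_le_sum_of_subset_of_nonneg (Finset.subset_univ S) fun u _ _ => hx0 _
  have h := Finset.sum_le_sum hin
  simp only [netOutflow, Finset.sum_sub_distrib]
  rw [Finset.sum_congr rfl hout, Finset.sum_comm]
  linarith

/-- In the support of a flow from `r` to `T`, every terminal is reachable from `r`. -/
lemma reachable_of_flow {V : Type*} [Fintype V] [DecidableEq V]
    {r : V} {T : Finset V} {x : V × V → ℝ}
    (hx0 : ∀ e, 0 ≤ x e)
    (hx : ∀ v, netOutflow x v = (if v = r then (T.card : ℝ) else 0) - (if v ∈ T then 1 else 0))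
    {t : V} (ht : t ∈ T) : Relation.ReflTransGen (fun u v => 0 < x (u, v)) r t := by
  by_contra hcon
  set S : Finset V := Finset.univ.filter fun v =>
    Relation.ReflTransGen (fun u v => 0 < x (u, v)) r v with hS
  have hrS : r ∈ S := by simp [hS, Relation.ReflTransGen.refl]
  have hclosed : ∀ u ∈ S, ∀ v ∉ S, x (u, v) = 0 := by
    intro u hu v hv
    simp only [hS, Finset.mem_filter, Finset.mem_univ, true_and] at hu hv
    by_contra hne
    exact hv (hu.tail ((hx0 _).lt_of_ne' hne))
  have hle := sum_netOutflow_nonpos hx0 S hclosed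
  simp only [hx, Finset.sum_sub_distrib, Finset.sum_ite_eq', hrS, if_true, Finset.sum_boole] at hle
  have hlt : (S.filter (· ∈ T)).card < T.card := by
    refine Finset.card_lt_card ⟨fun v hv => (Finset.mem_filter.1 hv).2, fun hsub => hcon ?_⟩
    have := (Finset.mem_filter.1 (hsub ht)).1
    simpa [hS] using this
  have : ((S.filter (· ∈ T)).card : ℝ) < T.card := by exact_mod_cast hlt
  linarith

/-- on a digraph with nonnegative edge costs, root `r` and terminals `T`
(each reachable from `r`), the minimum fixed cost of a flow sending `k = |T|` units from
`r` with one unit arriving at each terminal equals the optimum of the Directed Steiner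
Tree instance: the minimum cost of an edge set `H ⊆ E` containing a directed path from
`r` to every terminal.  (`∃ W` asserts that both minima exist and are equal.) -/
theorem stmt_15
    (V : Type*) [Fintype V] [DecidableEq V]
    (E : Finset (V × V)) (c : V × V → ℝ) (hc : ∀ e, 0 ≤ c e)
    (r : V) (T : Finset V) (hrT : r ∉ T) (k : ℕ) (hk : T.card = k)
    (hreach : ∀ t ∈ T, Relation.ReflTransGen (fun u v => (u, v) ∈ E) r t) :
    ∃ W : ℝ,
      IsLeast {w : ℝ | ∃ x : V × V → ℝ,
        (∀ e, 0 ≤ x e) ∧ (∀ e ∉ E, x e = 0) ∧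
        ((∑ u, x (r, u)) - (∑ u, x (u, r)) = (k : ℝ)) ∧
        (∀ t ∈ T, (∑ u, x (u, t)) - (∑ u, x (t, u)) = 1) ∧
        (∀ v, v ≠ r → v ∉ T → (∑ u, x (v, u)) - (∑ u, x (u, v)) = 0) ∧
        w = ∑ e ∈ Finset.univ.filter (fun e : V × V => 0 < x e), c e} W ∧
      IsLeast {w : ℝ | ∃ H : Finset (V × V), H ⊆ E ∧
        (∀ t ∈ T, Relation.ReflTransGen (fun u v => (u, v) ∈ H) r t) ∧
        w = ∑ e ∈ H, c e} W := by
  set F : Finset (Finset (V × V)) := E.powerset.filter fun H =>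
    ∀ t ∈ T, Relation.ReflTransGen (fun u v => (u, v) ∈ H) r t with hF
  have hmemF : ∀ H, H ∈ F ↔ H ⊆ E ∧
      ∀ t ∈ T, Relation.ReflTransGen (fun u v => (u, v) ∈ H) r t := fun H => by simp [hF]
  obtain ⟨H₀, hH₀, hmin⟩ := F.exists_min_image (fun H => ∑ e ∈ H, c e)
    ⟨E, (hmemF E).2 ⟨Finset.Subset.refl E, hreach⟩⟩
  have hsupp : ∀ x : V × V → ℝ, (∀ e, 0 ≤ x e) → (∀ e ∉ E, x e = 0) →
      (∀ v, netOutflow x v = (if v = r then (T.card : ℝ) else 0) - (if v ∈ T then 1 else 0)) →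
      ∑ e ∈ H₀, c e ≤ ∑ e ∈ Finset.univ.filter (fun e : V × V => 0 < x e), c e := by
    intro x hx0 hxE hx
    refine hmin _ ((hmemF _).2 ⟨fun e he => ?_, fun t ht => ?_⟩)
    · by_contra hne
      simp [hxE e hne] at he
    · simpa using reachable_of_flow hx0 hx ht
  obtain ⟨hH₀E, hH₀r⟩ := (hmemF H₀).1 hH₀
  refine ⟨∑ e ∈ H₀, c e, ⟨?_, ?_⟩, ⟨H₀, hH₀E, hH₀r, rfl⟩, ?_⟩
  · obtain ⟨x, hx0, hxH, hx⟩ := exists_flow_of_reachable hH₀r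
    have hxE : ∀ e ∉ E, x e = 0 := fun e he => hxH e fun h => he (hH₀E h)
    refine ⟨x, hx0, hxE, ?_, fun t ht => ?_, fun v hvr hvT => ?_, ?_⟩
    · simpa [netOutflow, hrT, hk] using hx r
    · have hxt := hx t
      have htr : t ≠ r := ne_of_mem_of_not_mem ht hrT
      simp only [netOutflow, htr, ht, if_true, if_false] at hxt
      linarith
    · simpa [netOutflow, hvr, hvT] using hx v
    · refine le_antisymm (hsupp x hx0 hxE hx)
        (Finset.sum_le_sum_of_subset_of_nonneg (fun e he => ?_) fun e _ _ => hc e)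
      by_contra hne
      simp [hxH e hne] at he
  · rintro w ⟨x, hx0, hxE, hxr, hxT, hxV, rfl⟩
    refine hsupp x hx0 hxE fun v => ?_
    by_cases hvr : v = r
    · subst hvr
      simpa [netOutflow, hrT, hk] using hxr
    · by_cases hvT : v ∈ T
      · have := hxT v hvT
        simp only [netOutflow, hvr, hvT, if_true, if_false]
        linarith
      · simpa [netOutflow, hvr, hvT] using hxV v hvr hvT
  · rintro w ⟨H, hHE, hHr, rfl⟩
    exact hmin H ((hmemF H).2 ⟨hHE, hHr⟩)
end

section
/- Let (V, U, EJ) be a bipartite graph with |V| = m ≥ 1 sets and |U| = n ≥ 1 elements in which every u ∈ U has at least one neighbor. Construct the following instance: sources are s* with supply n, and v_out with supply n for each v ∈ V; sinks are v_in with demand n for each v ∈ V, and u with demand 1 for each u ∈ U; the allowed edges are (s*, v_in) for every v ∈ V, (v_out, v_in) for every v ∈ V, and (v_out, u) for every (v, u) ∈ EJ. A feasible solution is a nonnegative flow on the allowed edges in which every source sends exactly its supply and every sink receives exactly its demand, and its cost is the number of vertices v ∈ V with positive flow on the edge (s*, v_in). Then the minimum cost over feasible solutions equals the minimum cardinality of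 a set V' ⊆ V that dominates U (i.e., every u ∈ U is adjacent to some v ∈ V'). -/
open Finset
open Classical

/-- `x` is a feasible flow of the transportation instance built from the bipartite graph `EJ`. -/
def IsFeasibleFlow {V U : Type*} [Fintype V] [Fintype U] (EJ : Finset (V × U))
    (n : ℕ) (x : Option V → (V ⊕ U) → ℝ) : Prop :=
  (∀ s t, 0 ≤ x s t) ∧
  (∀ u : U, x none (Sum.inr u) = 0) ∧
  (∀ v w : V, w ≠ v → x (some v) (Sum.inl w) = 0) ∧
  (∀ v : V, ∀ u : U, (v, u) ∉ EJ → x (some v) (Sum.inr u) = 0) ∧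
  (∑ t, x none t = (n : ℝ)) ∧
  (∀ v : V, ∑ t, x (some v) t = (n : ℝ)) ∧
  (∀ v : V, ∑ s, x s (Sum.inl v) = (n : ℝ)) ∧
  (∀ u : U, ∑ s, x s (Sum.inr u) = 1)

/-- The flow from `s*` into `v_in` is the total flow from `v_out` to the elements. -/
lemma IsFeasibleFlow.none_inl_eq {V U : Type*} [Fintype V] [Fintype U]
    {EJ : Finset (V × U)} {n : ℕ} {x : Option V → (V ⊕ U) → ℝ}
    (hx : IsFeasibleFlow EJ n x) (v : V) :
    x none (Sum.inl v) = ∑ u, x (some v) (Sum.inr u) := by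
  obtain ⟨-, -, hdiag, -, -, hout, hin, -⟩ := hx
  have h₁ := hout v
  have h₂ := hin v
  rw [Fintype.sum_sum_type, Fintype.sum_eq_single v fun w hw => hdiag v w hw] at h₁
  rw [Fintype.sum_option, Fintype.sum_eq_single v fun w hw => hdiag w v hw.symm] at h₂
  linarith

/-- The sets `v` whose edge `(s*, v_in)` is used by a feasible flow dominate all elements. -/
lemma IsFeasibleFlow.dominates {V U : Type*} [Fintype V] [Fintype U]
    {EJ : Finset (V × U)} {n : ℕ} {x : Option V → (V ⊕ U) → ℝ}
    (hx : IsFeasibleFlow EJ n x) (u : U) :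
    ∃ v, 0 < x none (Sum.inl v) ∧ (v, u) ∈ EJ := by
  have hbal := hx.none_inl_eq
  obtain ⟨hnn, hnone, -, hEJ, -, -, -, hdem⟩ := hx
  have hu := hdem u
  rw [Fintype.sum_option, hnone, zero_add] at hu
  obtain ⟨v, -, hv⟩ := exists_ne_zero_of_sum_ne_zero (hu.trans_ne one_ne_zero)
  refine ⟨v, ?_, not_imp_comm.mp (hEJ v u) hv⟩
  rw [hbal]
  exact sum_pos' (fun _ _ => hnn _ _) ⟨u, mem_univ u, (hnn _ _).lt_of_ne' hv⟩

/-- The flow that serves every element `u` from the set `f u`. -/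
def assignmentFlow {V U : Type*} [Fintype U] [DecidableEq V] (n : ℕ) (f : U → V) :
    Option V → (V ⊕ U) → ℝ
  | none, Sum.inl v => (#{u | f u = v} : ℝ)
  | none, Sum.inr _ => 0
  | some v, Sum.inl w => if w = v then n - (#{u | f u = v} : ℝ) else 0
  | some v, Sum.inr u => if f u = v then 1 else 0

lemma isFeasibleFlow_assignmentFlow {V U : Type*} [Fintype V] [Fintype U] [DecidableEq V]
    {EJ : Finset (V × U)} {n : ℕ} (hn : Fintype.card U = n) {f : U → V}
    (hf : ∀ u, (f u, u) ∈ EJ) : IsFeasibleFlow EJ n (assignmentFlow n f) := by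
  have hle (v : V) : (#{u | f u = v} : ℝ) ≤ n := by
    rw [← hn]
    exact_mod_cast card_le_univ _
  refine ⟨?_, fun u => rfl, fun v w hw => if_neg hw, ?_, ?_, ?_, ?_, ?_⟩
  · rintro (_ | v) (w | u) <;> simp only [assignmentFlow]
    · positivity
    · exact le_rfl
    · split_ifs
      · linarith [hle v]
      · exact le_rfl
    · split_ifs <;> norm_num
  · intro v u huv
    refine if_neg ?_
    rintro rfl
    exact huv (hf u)
  · have h : ∑ v, #{u | f u = v} = n := by
      rw [← hn, ← card_univ]
      exact (card_eq_sum_card_fiberwise fun _ _ => mem_univ _).symm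
    rw [Fintype.sum_sum_type]
    simp only [assignmentFlow, sum_const_zero, add_zero]
    exact_mod_cast h
  · intro v
    simp [Fintype.sum_sum_type, assignmentFlow]
  · intro v
    simp [Fintype.sum_option, assignmentFlow]
  · intro u
    simp [Fintype.sum_option, assignmentFlow]

lemma assignmentFlow_none_inl_pos {V U : Type*} [Fintype U] [DecidableEq V] {n : ℕ}
    {f : U → V} {v : V} : 0 < assignmentFlow n f none (Sum.inl v) ↔ ∃ u, f u = v := by
  simp [assignmentFlow, card_pos, Finset.Nonempty]

/-- reduction from Set Cover (bipartite domination) to FCT-S.  Sources are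
`s*` (encoded `none`, supply `n`) and `v_out` (encoded `some v`, supply `n`); sinks are
`v_in` (encoded `Sum.inl v`, demand `n`) and the elements `u` (encoded `Sum.inr u`,
demand `1`); only the allowed edges may carry flow.  The minimum number of vertices `v`
with positive flow on `(s*, v_in)` over all feasible flows equals the minimum size of a
dominating set `V' ⊆ V` for `U`. -/
theorem stmt_16
    (V U : Type*) [Fintype V] [Fintype U] [DecidableEq V] [DecidableEq U]
    (m n : ℕ) (hm : Fintype.card V = m) (hn : Fintype.card U = n)
    (hm1 : 1 ≤ m) (hn1 : 1 ≤ n)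
    (EJ : Finset (V × U))
    (hcov : ∀ u : U, ∃ v : V, (v, u) ∈ EJ) :
    ∃ cmin : ℕ,
      IsLeast {cst : ℕ | ∃ x : Option V → (V ⊕ U) → ℝ,
        (∀ s t, 0 ≤ x s t) ∧
        (∀ u : U, x none (Sum.inr u) = 0) ∧
        (∀ v w : V, w ≠ v → x (some v) (Sum.inl w) = 0) ∧
        (∀ v : V, ∀ u : U, (v, u) ∉ EJ → x (some v) (Sum.inr u) = 0) ∧
        (∑ t, x none t = (n : ℝ)) ∧
        (∀ v : V, ∑ t, x (some v) t = (n : ℝ)) ∧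
        (∀ v : V, ∑ s, x s (Sum.inl v) = (n : ℝ)) ∧
        (∀ u : U, ∑ s, x s (Sum.inr u) = 1) ∧
        cst = (Finset.univ.filter (fun v : V => 0 < x none (Sum.inl v))).card} cmin ∧
      IsLeast {k : ℕ | ∃ V' : Finset V,
        (∀ u : U, ∃ v ∈ V', (v, u) ∈ EJ) ∧ V'.card = k} cmin := by
  set S : Set ℕ := {k | ∃ V' : Finset V, (∀ u : U, ∃ v ∈ V', (v, u) ∈ EJ) ∧ V'.card = k}
  have hS : S.Nonempty := ⟨_, univ, fun u => by simpa using hcov u, rfl⟩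
  refine ⟨sInf S, ⟨?_, ?_⟩, Nat.sInf_mem hS, fun k hk => Nat.sInf_le hk⟩
  · obtain ⟨V', hdom, hcard⟩ := Nat.sInf_mem hS
    choose f hfV' hfEJ using hdom
    obtain ⟨h₁, h₂, h₃, h₄, h₅, h₆, h₇, h₈⟩ := isFeasibleFlow_assignmentFlow hn hfEJ
    refine ⟨assignmentFlow n f, h₁, h₂, h₃, h₄, h₅, h₆, h₇, h₈, le_antisymm ?_ ?_⟩
    · refine Nat.sInf_le ⟨_, fun u => ⟨f u, ?_, hfEJ u⟩, rfl⟩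
      exact mem_filter.mpr ⟨mem_univ _, assignmentFlow_none_inl_pos.mpr ⟨u, rfl⟩⟩
    · rw [← hcard]
      refine card_le_card fun v hv => ?_
      obtain ⟨u, rfl⟩ := assignmentFlow_none_inl_pos.mp (mem_filter.mp hv).2
      exact hfV' u
  · rintro _ ⟨x, h₁, h₂, h₃, h₄, h₅, h₆, h₇, h₈, rfl⟩
    have hx : IsFeasibleFlow EJ n x := ⟨h₁, h₂, h₃, h₄, h₅, h₆, h₇, h₈⟩
    refine Nat.sInf_le ⟨_, fun u => ?_, rfl⟩
    obtain ⟨v, hv, hvu⟩ := hx.dominates u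
    exact ⟨v, mem_filter.mpr ⟨mem_univ v, hv⟩, hvu⟩
end

section
/- Let G be a forest whose vertex set is the disjoint union of a set S with |S| = n ≥ 1 and a set T, all of whose edges join S to T, and in which every vertex of T has degree at least 1. Then the number of edges of G incident to a vertex of T of degree at least 2 is at most 2(n − 1). -/
open Finset

namespace SimpleGraph

variable {V α β : Type*}

lemma IsAcyclic.card_edgeSet_add_one_le [Finite V] [Nonempty V] {G : SimpleGraph V}
    (hG : G.IsAcyclic) : Nat.card G.edgeSet + 1 ≤ Nat.card V := by
  obtain ⟨T, hGT, -, hT⟩ := connected_top.exists_isTree_le_of_le_of_isAcyclic le_top hG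
  rw [← (isTree_iff_connected_and_card.mp hT).2, add_le_add_iff_right]
  exact Nat.card_mono (Set.toFinite _) (edgeSet_mono hGT)

lemma card_filter_adj_inl_inr [Fintype α] [Fintype β] {G : SimpleGraph (α ⊕ β)}
    [DecidableRel G.Adj] (h : ∀ j j' : β, ¬ G.Adj (Sum.inr j) (Sum.inr j')) (j : β) :
    #{i : α | G.Adj (Sum.inl i) (Sum.inr j)} = G.degree (Sum.inr j) := by
  rw [← card_neighborFinset_eq_degree, ← card_map Function.Embedding.inl]
  congr 1
  ext (i | j') <;> simp [h, G.adj_comm]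

/-- Each edge joining the left part to a vertex `j` on the right satisfying `p` is an edge of the
forest induced on the left part together with the vertices satisfying `p`. -/
lemma IsAcyclic.card_filter_adj_add_one_le [Fintype α] [Fintype β] [Nonempty α]
    {G : SimpleGraph (α ⊕ β)} [DecidableRel G.Adj] (hG : G.IsAcyclic)
    (p : β → Prop) [DecidablePred p] :
    #{e : α × β | G.Adj (Sum.inl e.1) (Sum.inr e.2) ∧ p e.2} + 1
      ≤ Fintype.card α + #{j : β | p j} := by
  let f : α ⊕ {j // p j} ↪ α ⊕ β :=
    (Function.Embedding.refl α).sumMap (Function.Embedding.subtype p)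
  have hforest := (hG.of_comap f).card_edgeSet_add_one_le
  rw [Nat.card_sum, Nat.card_eq_fintype_card (α := α),
    Nat.card_eq_fintype_card (α := {j // p j}), Fintype.card_subtype] at hforest
  refine le_trans (Nat.add_le_add_right ?_ 1) hforest
  rw [← Fintype.card_subtype, ← Nat.card_eq_fintype_card]
  refine Nat.card_le_card_of_injective
    (fun e ↦ ⟨s(Sum.inl e.1.1, Sum.inr ⟨e.1.2, e.2.2⟩), e.2.1⟩) ?_
  rintro ⟨⟨i, j⟩, _⟩ ⟨⟨i', j'⟩, _⟩ h
  simpa using congrArg Subtype.val h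

end SimpleGraph

/-- let `G` be a forest on the disjoint union of `S` (of size `n ≥ 1`) and
`T`, all of whose edges join `S` to `T`, with every vertex of `T` of degree at least 1.
Then the number of edges incident to a vertex of `T` of degree at least 2 is at most
`2(n − 1)`. -/
theorem stmt_17
    (α β : Type*) [Fintype α] [Fintype β] [DecidableEq α] [DecidableEq β]
    (n : ℕ) (hn : 1 ≤ n) (hcard : Fintype.card α = n)
    (G : SimpleGraph (α ⊕ β)) [DecidableRel G.Adj]
    (hforest : G.IsAcyclic)
    (hbip1 : ∀ i i' : α, ¬ G.Adj (Sum.inl i) (Sum.inl i'))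
    (hbip2 : ∀ j j' : β, ¬ G.Adj (Sum.inr j) (Sum.inr j'))
    (hdeg : ∀ j : β, 1 ≤ G.degree (Sum.inr j)) :
    ((Finset.univ : Finset (α × β)).filter
      (fun p => G.Adj (Sum.inl p.1) (Sum.inr p.2) ∧ 2 ≤ G.degree (Sum.inr p.2))).card
      ≤ 2 * (n - 1) := by
  have : Nonempty α := Fintype.card_pos_iff.mp (by omega)
  have hupper := hforest.card_filter_adj_add_one_le (fun j ↦ 2 ≤ G.degree (Sum.inr j))
  have hlower : 2 * #{j : β | 2 ≤ G.degree (Sum.inr j)} ≤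
      #{e : α × β | G.Adj (Sum.inl e.1) (Sum.inr e.2) ∧ 2 ≤ G.degree (Sum.inr e.2)} := by
    refine mul_card_image_le_card_of_maps_to (f := Prod.snd) ?_ 2 fun j hj ↦ ?_
    · simp
    have hj' : 2 ≤ G.degree (Sum.inr j) := by simpa using hj
    rw [← SimpleGraph.card_filter_adj_inl_inr hbip2] at hj'
    refine hj'.trans (card_le_card_of_injOn (fun i ↦ (i, j)) ?_ (by simp [Set.InjOn]))
    intro i hi
    simp_all
  omega
end

section
/- Let E' be a finite set, ε ∈ (0, 1], y : E' → [0, 1], p : E' → ℝ_{>0}, w : E' → ℝ_{≥0}, and let V > 0 satisfy p_e ≤ V for all e ∈ E'. Then there exists y' : E' → [0, 1] such that: (i) y'_e = y_e for every e with y_e ≥ ε; (ii) y'_e ∈ {0, ε} for every e with y_e < ε; (iii) ∑_{e ∈ E'} p_e y'_e ≤ ∑_{e ∈ E'} p_e y_e and ∑_{e ∈ E'} p_e y'_e > ∑_{e ∈ E'} p_e y_e − ε·V; and (iv) ∑_{e ∈ E'} w_e y'_e ≤ ∑_{e ∈ E'} w_e y_e. -/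
open Finset

/-- The vector obtained from `y` by rounding entries `< ε` to `ε` on `T` and to `0` off `T`. -/
noncomputable def roundOn {α : Type*} (ε : ℝ) (y : α → ℝ) (T : Finset α) (e : α) : ℝ :=
  open Classical in if y e < ε then (if e ∈ T then ε else 0) else y e

open Classical in
theorem sum_mul_roundOn_insert {α : Type*} [Fintype α] {ε : ℝ} {y : α → ℝ} {T : Finset α} {k : α}
    (hk : y k < ε) (hkT : k ∉ T) (p : α → ℝ) :
    ∑ e, p e * roundOn ε y (insert k T) e = ∑ e, p e * roundOn ε y T e + p k * ε := by
  have h : ∀ e, p e * roundOn ε y (insert k T) e =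
      p e * roundOn ε y T e + if e = k then p k * ε else 0 := by
    intro e
    by_cases hek : e = k
    · subst hek
      simp [roundOn, hk, hkT]
    · simp [roundOn, hek]
  simp [h, Finset.sum_add_distrib]

/-- If `T` separates the ratios `w e / p e` of the small entries at level `l`, rounding on `T` without
increasing the `p`-sum does not increase the `w`-sum either. -/
theorem sum_mul_roundOn_le_of_threshold {α : Type*} [Fintype α] {ε l : ℝ} {y p w : α → ℝ}
    {T : Finset α} (hy : ∀ e, 0 ≤ y e) (hl : 0 ≤ l)
    (hin : ∀ e ∈ T, w e ≤ l * p e) (hout : ∀ e ∉ T, y e < ε → l * p e ≤ w e)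
    (hsum : ∑ e, p e * roundOn ε y T e ≤ ∑ e, p e * y e) :
    ∑ e, w e * roundOn ε y T e ≤ ∑ e, w e * y e := by
  have h : ∑ e, (w e * roundOn ε y T e + l * (p e * y e)) ≤
      ∑ e, (w e * y e + l * (p e * roundOn ε y T e)) := by
    refine Finset.sum_le_sum fun e _ => ?_
    unfold roundOn
    split_ifs with hs hT
    · nlinarith [mul_nonneg (sub_nonneg.2 (hin e hT)) (sub_nonneg.2 hs.le)]
    · nlinarith [mul_nonneg (sub_nonneg.2 (hout e hT hs)) (hy e)]
    · exact le_rfl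
  simp only [Finset.sum_add_distrib, ← Finset.mul_sum] at h
  nlinarith [mul_le_mul_of_nonneg_left hsum hl]

/-- the rounding lemma.  Given `y : E' → [0,1]`, positive `p ≤ V`, and
nonnegative weights `w`, there is `y' : E' → [0,1]` that keeps entries `≥ ε` unchanged,
rounds entries `< ε` to `0` or `ε`, does not increase `∑ p y` nor `∑ w y`, and decreases
`∑ p y` by strictly less than `ε·V`. -/
theorem stmt_19
    (E' : Type*) [Fintype E']
    (ε : ℝ) (hε0 : 0 < ε) (hε1 : ε ≤ 1)
    (y : E' → ℝ) (hy : ∀ e, 0 ≤ y e ∧ y e ≤ 1)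
    (p : E' → ℝ) (hp : ∀ e, 0 < p e)
    (w : E' → ℝ) (hw : ∀ e, 0 ≤ w e)
    (V : ℝ) (hV : 0 < V) (hpV : ∀ e, p e ≤ V) :
    ∃ y' : E' → ℝ,
      (∀ e, 0 ≤ y' e ∧ y' e ≤ 1) ∧
      (∀ e, ε ≤ y e → y' e = y e) ∧
      (∀ e, y e < ε → y' e = 0 ∨ y' e = ε) ∧
      (∑ e, p e * y' e ≤ ∑ e, p e * y e) ∧
      ((∑ e, p e * y e) - ε * V < ∑ e, p e * y' e) ∧
      (∑ e, w e * y' e ≤ ∑ e, w e * y e) := by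
  classical
  let S : Finset E' := univ.filter fun e => y e < ε
  let F : Finset (Finset E') := S.powerset.filter fun T =>
    (∀ a ∈ T, ∀ b ∈ S \ T, w a / p a ≤ w b / p b) ∧
      ∑ e, p e * roundOn ε y T e ≤ ∑ e, p e * y e
  have hF : F.Nonempty := by
    refine ⟨∅, ?_⟩
    simp only [F, mem_filter, empty_mem_powerset, true_and]
    refine ⟨by simp, Finset.sum_le_sum fun e _ => mul_le_mul_of_nonneg_left ?_ (hp e).le⟩
    unfold roundOn
    split_ifs with h1 h2
    · simp at h2
    · exact (hy e).1
    · exact le_rfl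
  obtain ⟨T, hT, hmax⟩ := F.exists_max_image card hF
  simp only [F, mem_filter, mem_powerset] at hT
  obtain ⟨hTS, hsep, hsum⟩ := hT
  refine ⟨roundOn ε y T, fun e => ?_, fun e he => ?_, fun e he => ?_, hsum, ?_⟩
  · unfold roundOn
    split_ifs
    exacts [⟨hε0.le, hε1⟩, ⟨le_rfl, zero_le_one⟩, hy e]
  · simp [roundOn, he.not_gt]
  · by_cases h : e ∈ T <;> simp [roundOn, he, h]
  · obtain hST | hST := (S \ T).eq_empty_or_nonempty
    · have hmem : ∀ e, y e < ε → e ∈ T := fun e he =>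
        sdiff_eq_empty_iff_subset.1 hST (by simp [S, he])
      have hle : ∀ e, y e ≤ roundOn ε y T e := by
        intro e
        by_cases he : y e < ε
        · simp [roundOn, he, hmem e he, he.le]
        · simp [roundOn, he]
      have heq : ∀ e, roundOn ε y T e = y e := by
        have hterm : ∀ e ∈ univ, p e * y e ≤ p e * roundOn ε y T e := fun e _ =>
          mul_le_mul_of_nonneg_left (hle e) (hp e).le
        have := (Finset.sum_eq_sum_iff_of_le hterm).1 (le_antisymm (sum_le_sum hterm) hsum)
        exact fun e => (mul_left_cancel₀ (hp e).ne' (this e (mem_univ e))).symm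
      simp only [heq]
      exact ⟨by linarith [mul_pos hε0 hV], le_rfl⟩
    · obtain ⟨k, hk, hmin⟩ := (S \ T).exists_min_image (fun e => w e / p e) hST
      obtain ⟨hkS, hkT⟩ := mem_sdiff.1 hk
      have hky : y k < ε := by simpa [S] using hkS
      constructor
      · by_contra! hcon
        have hins : insert k T ∈ F := by
          simp only [F, mem_filter, mem_powerset]
          refine ⟨insert_subset hkS hTS, fun a ha b hb => ?_, ?_⟩
          · have hb' : b ∈ S \ T := by
              simp only [mem_sdiff, mem_insert, not_or] at hb ⊢
              exact ⟨hb.1, hb.2.2⟩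
            obtain rfl | ha := mem_insert.1 ha
            exacts [hmin b hb', hsep a ha b hb']
          · rw [sum_mul_roundOn_insert hky hkT]
            nlinarith [mul_le_mul_of_nonneg_right (hpV k) hε0.le]
        have := hmax _ hins
        rw [card_insert_of_notMem hkT] at this
        omega
      · refine sum_mul_roundOn_le_of_threshold (l := w k / p k) (fun e => (hy e).1)
          (div_nonneg (hw k) (hp k).le) (fun e he => ?_) (fun e he hey => ?_) hsum
        · exact (div_le_iff₀ (hp e)).1 (hsep e he k hk)
        · exact (le_div_iff₀ (hp e)).1 (hmin e (by simp [S, he, hey]))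
end
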